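/- If M is an indecomposable preprojective k(Γ,Λ)-module, then M ≅ M(S) for some sequence S = x₁,…,x_s ∈ 𝔖 with s > 0 such that the word w(S) ∈ W is reduced, where M(S) = F_{x₁}⁻F_{x₂}⁻⋯F_{x_{s−1}}⁻(L_{x_s}) and L_{x_s} is the simple projective k(Γ,σ_{x_{s−1}}⋯σ_{x₁}Λ)-module associated to the vertex x_s. -/

import Mathlib

namespace KP

/-! ## Quivers on a fixed vertex set `Fin n`.

An orientation is encoded by `Λ : Fin n → Fin n → ℕ`, where `Λ a b` is the number of
arrows from `a` to `b`.  The underlying graph is recorded by `edges Λ a b = Λ a b + Λ b a`. -/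

/-- The orientation `σ_x Λ` obtained by reversing every arrow incident with `x`. -/
def flipO {n : ℕ} (x : Fin n) (Λ : Fin n → Fin n → ℕ) : Fin n → Fin n → ℕ :=
  fun a b => if a = x ∨ b = x then Λ b a else Λ a b

/-- Number of edges of the underlying graph joining `a` and `b`. -/
def edges {n : ℕ} (Λ : Fin n → Fin n → ℕ) (a b : Fin n) : ℕ := Λ a b + Λ b a

/-- `x` is a sink: no arrow starts at `x`. -/
def IsSink {n : ℕ} (Λ : Fin n → Fin n → ℕ) (x : Fin n) : Prop := ∀ y, Λ x y = 0

/-- `S` is a `(+)`-admissible sequence of vertices on `(Γ, Λ)`. -/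
def Admissible {n : ℕ} (Λ : Fin n → Fin n → ℕ) : List (Fin n) → Prop
  | [] => True
  | x :: xs => IsSink Λ x ∧ Admissible (flipO x Λ) xs

/-- The orientation `Λ^S`. -/
def orientAfter {n : ℕ} (Λ : Fin n → Fin n → ℕ) : List (Fin n) → (Fin n → Fin n → ℕ)
  | [] => Λ
  | x :: xs => orientAfter (flipO x Λ) xs

/-- Elementary move: interchange two consecutive vertices not joined by an edge. -/
inductive SwapRel {n : ℕ} (E : Fin n → Fin n → ℕ) : List (Fin n) → List (Fin n) → Prop
  | swap (l₁ l₂ : List (Fin n)) (a b : Fin n) (h : E a b = 0) :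
      SwapRel E (l₁ ++ a :: b :: l₂) (l₁ ++ b :: a :: l₂)

/-- The equivalence `∼` on sequences of vertices: reflexive–transitive closure of the
(symmetric) relation `SwapRel`. -/
def Sim {n : ℕ} (E : Fin n → Fin n → ℕ) : List (Fin n) → List (Fin n) → Prop :=
  Relation.ReflTransGen (SwapRel E)

/-- The preorder `S ⪯ T` : `T ∼ S ++ U` for some `(+)`-admissible sequence `U` on `(Γ, Λ^S)`. -/
def Preceq {n : ℕ} (Λ : Fin n → Fin n → ℕ) (S T : List (Fin n)) : Prop :=
  ∃ U, Admissible (orientAfter Λ S) U ∧ Sim (edges Λ) T (S ++ U)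

/-- Support of a sequence of vertices. -/
def suppOf {n : ℕ} (S : List (Fin n)) : Set (Fin n) := {v | v ∈ S}

/-- The partial order on vertices: `x ≤ y` iff there is a path from `x` to `y` in `(Γ, Λ)`. -/
def PathLE {n : ℕ} (Λ : Fin n → Fin n → ℕ) (x y : Fin n) : Prop :=
  Relation.ReflTransGen (fun a b => Λ a b ≠ 0) x y

/-- A filter (up-closed set) of the poset `(Γ₀, Λ)`. -/
def IsFilter {n : ℕ} (Λ : Fin n → Fin n → ℕ) (F : Set (Fin n)) : Prop :=
  ∀ x ∈ F, ∀ y, PathLE Λ x y → y ∈ F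

/-- The principal filter `⟨x⟩`. -/
def upSet {n : ℕ} (Λ : Fin n → Fin n → ℕ) (x : Fin n) : Set (Fin n) := {y | PathLE Λ x y}

/-- The hull `H_Λ(F)`: the smallest filter containing `F` and every vertex joined
by an edge to a vertex of `F`. -/
def hull {n : ℕ} (Λ : Fin n → Fin n → ℕ) (F : Set (Fin n)) : Set (Fin n) :=
  {y | ∃ x, (x ∈ F ∨ ∃ z ∈ F, edges Λ z x ≠ 0) ∧ PathLE Λ x y}

/-- `segs` is a canonical form of `S` (Proposition 2.1): `S ∼ S₁S₂⋯S_r`, each segment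
consists of distinct vertices, is nonempty, and `Supp S_i = Supp (S_i S_{i+1} ⋯ S_r)`. -/
def Segments {n : ℕ} (Λ : Fin n → Fin n → ℕ) (S : List (Fin n))
    (segs : List (List (Fin n))) : Prop :=
  Admissible Λ segs.flatten ∧ Sim (edges Λ) S segs.flatten ∧
  (∀ seg ∈ segs, seg ≠ [] ∧ seg.Nodup) ∧
  ∀ i, i < segs.length → suppOf (segs.getD i []) = suppOf ((segs.drop i).flatten)

/-- `J` is (a representative of) the join `S ∨ T` (Definition 2.4):  the canonical form of `J`
has `Supp R_i = Supp S_i ∪ Supp T_i` (out-of-range segments read as `∅`). -/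
def IsJoin {n : ℕ} (Λ : Fin n → Fin n → ℕ) (S T J : List (Fin n)) : Prop :=
  ∃ CS CT CJ, Segments Λ S CS ∧ Segments Λ T CT ∧ Segments Λ J CJ ∧
    ∀ i, suppOf (CJ.getD i []) = suppOf (CS.getD i []) ∪ suppOf (CT.getD i [])

/-- `M` is (a representative of) the meet `S ∧ T` (Definition 2.4). -/
def IsMeet {n : ℕ} (Λ : Fin n → Fin n → ℕ) (S T M : List (Fin n)) : Prop :=
  ∃ CS CT CM, Segments Λ S CS ∧ Segments Λ T CT ∧ Segments Λ M CM ∧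
    ∀ i, suppOf (CM.getD i []) = suppOf (CS.getD i []) ∩ suppOf (CT.getD i [])

/-- `S` is (equivalent to) the join `T₁ ∨ ⋯ ∨ T_l` of the list of sequences `Ts`. -/
def IsJoinList {n : ℕ} (Λ : Fin n → Fin n → ℕ) : List (List (Fin n)) → List (Fin n) → Prop
  | [], S => S = []
  | T :: Ts, S => ∃ J, IsJoinList Λ Ts J ∧ IsJoin Λ T J S

/-- The segments of a canonical form of a principal sequence `S_{r,x}` (Definition 3.1). -/
def PrincipalSegs {n : ℕ} (Λ : Fin n → Fin n → ℕ) (segs : List (List (Fin n)))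
    (r : ℕ) (x : Fin n) : Prop :=
  segs.length = r ∧ 0 < r ∧
  (∀ i, i + 1 < r → suppOf (segs.getD i []) = hull Λ (suppOf (segs.getD (i+1) []))) ∧
  suppOf (segs.getD (r-1) []) = upSet Λ x

/-- `S ∼ S_{r,x}`, the principal `(+)`-admissible sequence of size `r` with
`Supp S_r = ⟨x⟩`. -/
def IsPrincipalSeq {n : ℕ} (Λ : Fin n → Fin n → ℕ) (r : ℕ) (x : Fin n)
    (S : List (Fin n)) : Prop :=
  ∃ segs, Segments Λ S segs ∧ PrincipalSegs Λ segs r x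

/-- `S` is a principal `(+)`-admissible sequence. -/
def IsPrincipal {n : ℕ} (Λ : Fin n → Fin n → ℕ) (S : List (Fin n)) : Prop :=
  ∃ r x, IsPrincipalSeq Λ r x S


/-! ## Representations of `(Γ, Λ)` over a field `k`. -/

/-- A (finite-dimensional) representation of the quiver `(Γ, Λ)` over `k`:
the space at vertex `x` is `Fin (d x) → k`, and each arrow carries a linear map. -/
structure Rep (k : Type) [Field k] (n : ℕ) (Λ : Fin n → Fin n → ℕ) where
  d : Fin n → ℕ
  f : ∀ a b : Fin n, Fin (Λ a b) → ((Fin (d a) → k) →ₗ[k] (Fin (d b) → k))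

variable {k : Type} [Field k] {n : ℕ}

/-- A morphism of representations. -/
structure RepHom {Λ : Fin n → Fin n → ℕ} (M N : Rep k n Λ) where
  g : ∀ x, (Fin (M.d x) → k) →ₗ[k] (Fin (N.d x) → k)
  comm : ∀ a b i v, g b (M.f a b i v) = N.f a b i (g a v)

/-- Isomorphism of representations. -/
def RepIso {Λ : Fin n → Fin n → ℕ} (M N : Rep k n Λ) : Prop :=
  ∃ g : ∀ x, (Fin (M.d x) → k) ≃ₗ[k] (Fin (N.d x) → k),
    ∀ a b i v, g b (M.f a b i v) = N.f a b i (g a v)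

/-- The zero representation. -/
def IsZeroRep {Λ : Fin n → Fin n → ℕ} (M : Rep k n Λ) : Prop := ∀ x, M.d x = 0

/-- Cast between the standard spaces. -/
def castL (k : Type) [Field k] {m m' : ℕ} (h : m = m') : (Fin m → k) ≃ₗ[k] (Fin m' → k) :=
  LinearEquiv.funCongrLeft k k (finCongr h.symm)

/-- The splitting `(Fin (m + p) → k) ≃ₗ (Fin m → k) × (Fin p → k)`. -/
def splitL (k : Type) [Field k] (m p : ℕ) : (Fin (m + p) → k) ≃ₗ[k] (Fin m → k) × (Fin p → k) :=
  (LinearEquiv.funCongrLeft k k finSumFinEquiv).trans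
    (LinearEquiv.sumArrowLequivProdArrow _ _ k k)

/-- Direct sum of two representations. -/
def dSum {Λ : Fin n → Fin n → ℕ} (M N : Rep k n Λ) : Rep k n Λ where
  d x := M.d x + N.d x
  f a b i :=
    (splitL k (M.d b) (N.d b)).symm.toLinearMap ∘ₗ
      (LinearMap.prodMap (M.f a b i) (N.f a b i)) ∘ₗ (splitL k (M.d a) (N.d a)).toLinearMap

/-- The zero representation (as an object). -/
def zeroRep (k : Type) [Field k] (n : ℕ) (Λ : Fin n → Fin n → ℕ) : Rep k n Λ where
  d _ := 0
  f _ _ _ := 0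

/-- Direct sum of a list of representations. -/
def dSumList {Λ : Fin n → Fin n → ℕ} (L : List (Rep k n Λ)) : Rep k n Λ :=
  L.foldr dSum (zeroRep k n Λ)

/-- `M` is indecomposable. -/
def Indecomp {Λ : Fin n → Fin n → ℕ} (M : Rep k n Λ) : Prop :=
  ¬ IsZeroRep M ∧ ∀ A B : Rep k n Λ, RepIso M (dSum A B) → IsZeroRep A ∨ IsZeroRep B

/-- `X` is a direct summand of `M`. -/
def IsSummand {Λ : Fin n → Fin n → ℕ} (X M : Rep k n Λ) : Prop :=
  ∃ Y, RepIso M (dSum X Y)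

/-! ### Reflection functors (on objects) -/

/-- Index type of the arrows ending at `x`. -/
abbrev Arin {n : ℕ} (Λ : Fin n → Fin n → ℕ) (x : Fin n) := Σ y : Fin n, Fin (Λ y x)

/-- Index type of the arrows starting at `x`. -/
abbrev Aout {n : ℕ} (Λ : Fin n → Fin n → ℕ) (x : Fin n) := Σ y : Fin n, Fin (Λ x y)

/-- The map `h : ⊕_{a : y → x} V(y) → V(x)` induced by the maps along the arrows ending at `x`. -/
noncomputable def inMap (Λ : Fin n → Fin n → ℕ) (M : Rep k n Λ) (x : Fin n) :
    ((p : Arin Λ x) → (Fin (M.d p.1) → k)) →ₗ[k] (Fin (M.d x) → k) :=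
  ∑ p : Arin Λ x, (M.f p.1 x p.2) ∘ₗ LinearMap.proj p

/-- The map `h' : V(x) → ⊕_{a : x → y} V(y)` induced by the maps along arrows starting at `x`. -/
def outMap (Λ : Fin n → Fin n → ℕ) (M : Rep k n Λ) (x : Fin n) :
    (Fin (M.d x) → k) →ₗ[k] ((p : Aout Λ x) → (Fin (M.d p.1) → k)) :=
  LinearMap.pi fun p => M.f x p.1 p.2

noncomputable def kerEquiv (Λ : Fin n → Fin n → ℕ) (M : Rep k n Λ) (x : Fin n) :
    LinearMap.ker (inMap Λ M x) ≃ₗ[k]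
      (Fin (Module.finrank k (LinearMap.ker (inMap Λ M x))) → k) :=
  (Module.finBasis k _).equivFun

noncomputable def cokerEquiv (Λ : Fin n → Fin n → ℕ) (M : Rep k n Λ) (x : Fin n) :
    (((p : Aout Λ x) → (Fin (M.d p.1) → k)) ⧸ LinearMap.range (outMap Λ M x)) ≃ₗ[k]
      (Fin (Module.finrank k (((p : Aout Λ x) → (Fin (M.d p.1) → k)) ⧸
        LinearMap.range (outMap Λ M x))) → k) :=
  (Module.finBasis k _).equivFun

/-- The positive reflection functor `F_x⁺` (on objects): the space at `x` is replaced
by the kernel of `inMap`, with the maps along the reversed arrows induced by inclusion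
followed by the projections. -/
noncomputable def reflPlus (x : Fin n) (Λ : Fin n → Fin n → ℕ) (M : Rep k n Λ) :
    Rep k n (flipO x Λ) where
  d z := if z = x then Module.finrank k (LinearMap.ker (inMap Λ M x)) else M.d z
  f a b i :=
    if ha : a = x then
      if hb : b = x then 0
      else
        (castL k (if_neg hb).symm).toLinearMap ∘ₗ
          (LinearMap.proj (φ := fun p : Arin Λ x => Fin (M.d p.1) → k)
            (⟨b, Fin.cast (by subst ha; simp [flipO]) i⟩ : Arin Λ x)) ∘ₗ
          (LinearMap.ker (inMap Λ M x)).subtype ∘ₗ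
          (kerEquiv Λ M x).symm.toLinearMap ∘ₗ (castL k (if_pos ha)).toLinearMap
    else
      if hb : b = x then 0
      else
        (castL k (if_neg hb).symm).toLinearMap ∘ₗ
          M.f a b (Fin.cast (by simp [flipO, ha, hb]) i) ∘ₗ
          (castL k (if_neg ha)).toLinearMap

/-- The negative reflection functor `F_x⁻` (on objects), presented as a map from
representations of `(Γ, σ_x Λ)` to representations of `(Γ, Λ)`: the space at `x` is
replaced by the cokernel of `outMap`. -/
noncomputable def reflMinus (x : Fin n) (Λ : Fin n → Fin n → ℕ)
    (N : Rep k n (flipO x Λ)) : Rep k n Λ where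
  d z := if z = x then
      Module.finrank k (((p : Aout (flipO x Λ) x) → (Fin (N.d p.1) → k)) ⧸
        LinearMap.range (outMap (flipO x Λ) N x))
    else N.d z
  f a b i :=
    if hb : b = x then
      if ha : a = x then 0
      else
        (castL k (if_pos hb).symm).toLinearMap ∘ₗ
          (cokerEquiv (flipO x Λ) N x).toLinearMap ∘ₗ
          (LinearMap.range (outMap (flipO x Λ) N x)).mkQ ∘ₗ
          (LinearMap.single k (fun p : Aout (flipO x Λ) x => Fin (N.d p.1) → k)
            (⟨a, Fin.cast (by subst hb; simp [flipO]) i⟩ : Aout (flipO x Λ) x)) ∘ₗ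
          (castL k (if_neg ha)).toLinearMap
    else
      if ha : a = x then 0
      else
        (castL k (if_neg hb).symm).toLinearMap ∘ₗ
          N.f a b (Fin.cast (by simp [flipO, ha, hb]) i) ∘ₗ
          (castL k (if_neg ha)).toLinearMap

/-- `F(S) = F_{x_s}⁺ ⋯ F_{x_1}⁺` applied to a representation. -/
noncomputable def FList : (S : List (Fin n)) → (Λ : Fin n → Fin n → ℕ) → Rep k n Λ →
    Rep k n (orientAfter Λ S)
  | [], _, M => M
  | x :: xs, Λ, M => FList xs (flipO x Λ) (reflPlus x Λ M)

/-- `S` annihilates `M` : `F(S) M = 0`. -/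
def Annihilates (Λ : Fin n → Fin n → ℕ) (S : List (Fin n)) (M : Rep k n Λ) : Prop :=
  IsZeroRep (FList S Λ M)

/-- `M` is preprojective: some `(+)`-admissible sequence annihilates it. -/
def Preprojective (Λ : Fin n → Fin n → ℕ) (M : Rep k n Λ) : Prop :=
  ∃ S, Admissible Λ S ∧ Annihilates Λ S M

/-- `S` is a shortest `(+)`-admissible sequence annihilating `M` : it annihilates `M` and no
proper subsequence of `S` annihilates `M`.  (This predicate is invariant under `∼`, so it
expresses `S ∼ S_M`.) -/
def IsShortestAnn (Λ : Fin n → Fin n → ℕ) (M : Rep k n Λ) (S : List (Fin n)) : Prop :=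
  Admissible Λ S ∧ Annihilates Λ S M ∧
  ∀ S', Admissible Λ S' → Annihilates Λ S' M → Preceq Λ S' S → Sim (edges Λ) S' S

/-- The simple representation `L_x` concentrated at the vertex `x`. -/
def simpleRep (Λ : Fin n → Fin n → ℕ) (x : Fin n) : Rep k n Λ where
  d z := if z = x then 1 else 0
  f _ _ _ := 0

/-- `M(S) = F_{x₁}⁻ F_{x₂}⁻ ⋯ F_{x_{s-1}}⁻ (L_{x_s})`, where `L_{x_s}` is the simple
(projective) module over `k(Γ, σ_{x_{s-1}} ⋯ σ_{x_1} Λ)` at the vertex `x_s`. -/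
noncomputable def Mof : (Λ : Fin n → Fin n → ℕ) → (S : List (Fin n)) → Rep k n Λ
  | Λ, [] => zeroRep k n Λ
  | Λ, [x] => simpleRep Λ x
  | Λ, x :: y :: ys => reflMinus x Λ (Mof (flipO x Λ) (y :: ys))

variable {n : ℕ}

/-! ## The Weyl group -/

/-- The simple reflection `σ_i` attached to a generalized Cartan matrix `A`,
as a linear endomorphism of `ℤⁿ` : `σ_i(v) = v - (∑ l, a_{il} v_l) e_i`. -/
def sigmaL (A : Fin n → Fin n → ℤ) (i : Fin n) : (Fin n → ℤ) →ₗ[ℤ] (Fin n → ℤ) where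
  toFun v := v - (∑ l, A i l * v l) • Pi.single i 1
  map_add' v w := by
    simp only [Pi.add_apply, mul_add, Finset.sum_add_distrib, add_smul]
    abel
  map_smul' c v := by
    simp only [Pi.smul_apply, smul_eq_mul, RingHom.id_apply, smul_sub]
    congr 1
    rw [smul_smul, Finset.mul_sum]
    congr 1
    exact Finset.sum_congr rfl fun l _ => by ring

theorem sigma_invol (A : Fin n → Fin n → ℤ) (hA : ∀ i, A i i = 2) (i : Fin n) :
    (sigmaL A i).comp (sigmaL A i) = LinearMap.id := by
  apply LinearMap.ext
  intro v
  simp only [LinearMap.comp_apply, LinearMap.id_apply, sigmaL, LinearMap.coe_mk, AddHom.coe_mk]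
  set c := ∑ l, A i l * v l with hc
  set s : Fin n → ℤ := Pi.single i 1 with hs
  have h1 : ∑ l, A i l * (v - c • s) l = -c := by
    have h2 : ∀ l, A i l * (v - c • s) l = A i l * v l - c * (A i l * s l) := fun l => by
      simp only [Pi.sub_apply, Pi.smul_apply, smul_eq_mul]
      ring
    rw [Finset.sum_congr rfl fun l _ => h2 l, Finset.sum_sub_distrib, ← Finset.mul_sum]
    have h3 : ∑ l, A i l * s l = 2 := by
      rw [Finset.sum_eq_single i]
      · simp [hs, hA i]
      · intro b _ hb
        simp [hs, Pi.single_eq_of_ne hb]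
      · simp
    rw [h3, ← hc]
    ring
  rw [h1]
  ext j
  simp only [Pi.sub_apply, Pi.smul_apply, smul_eq_mul]
  ring

/-- The simple reflection `σ_i` as an automorphism of `ℤⁿ`. -/
def sigmaE (A : Fin n → Fin n → ℤ) (hA : ∀ i, A i i = 2) (i : Fin n) :
    (Fin n → ℤ) ≃ₗ[ℤ] (Fin n → ℤ) :=
  LinearEquiv.ofLinear (sigmaL A i) (sigmaL A i) (sigma_invol A hA i) (sigma_invol A hA i)

/-- The length `ℓ(w)`: the least `l ≥ 0` such that `w` is a product of `l` simple
reflections. -/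
noncomputable def wordLen (A : Fin n → Fin n → ℤ) (hA : ∀ i, A i i = 2)
    (w : (Fin n → ℤ) ≃ₗ[ℤ] (Fin n → ℤ)) : ℕ :=
  sInf {l | ∃ ys : List (Fin n), ys.length = l ∧ w = (ys.map (sigmaE A hA)).prod}

/-- The word `w(S) = σ_{x_s} ⋯ σ_{x_1}` associated to a sequence `S = x₁, …, x_s`. -/
def wordOf (A : Fin n → Fin n → ℤ) (hA : ∀ i, A i i = 2) (S : List (Fin n)) :
    (Fin n → ℤ) ≃ₗ[ℤ] (Fin n → ℤ) :=
  ((S.reverse).map (sigmaE A hA)).prod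

/-- The symmetric generalized Cartan matrix of the underlying graph of `(Γ, Λ)`. -/
def cartanOf (Λ : Fin n → Fin n → ℕ) : Fin n → Fin n → ℤ :=
  fun i j => if i = j then 2 else -(edges Λ i j : ℤ)

theorem cartan_diag (Λ : Fin n → Fin n → ℕ) : ∀ i, cartanOf Λ i i = 2 := by
  intro i; simp [cartanOf]

/-- The simple reflections of the Weyl group of the underlying graph of `(Γ, Λ)`. -/
def wSig (Λ : Fin n → Fin n → ℕ) : Fin n → ((Fin n → ℤ) ≃ₗ[ℤ] (Fin n → ℤ)) :=
  sigmaE (cartanOf Λ) (cartan_diag Λ)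

/-- `w(S)` for a sequence of vertices of `(Γ, Λ)`. -/
def wordOfSeq (Λ : Fin n → Fin n → ℕ) (S : List (Fin n)) :
    (Fin n → ℤ) ≃ₗ[ℤ] (Fin n → ℤ) :=
  ((S.reverse).map (wSig Λ)).prod

/-- The word `w(S)` is reduced: `ℓ(w(S))` equals the number of letters of `S`. -/
noncomputable def IsReducedSeq (Λ : Fin n → Fin n → ℕ) (S : List (Fin n)) : Prop :=
  wordLen (cartanOf Λ) (cartan_diag Λ) (wordOfSeq Λ S) = S.length

/-! ## Dynkin graphs of types A, D, E -/

def edgeA (n : ℕ) : Fin n → Fin n → ℕ := fun i j =>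
  if (i : ℕ) + 1 = (j : ℕ) ∨ (j : ℕ) + 1 = (i : ℕ) then 1 else 0

def edgeD (n : ℕ) : Fin n → Fin n → ℕ := fun i j =>
  if ((i : ℕ) = 0 ∧ (j : ℕ) = 2) ∨ ((j : ℕ) = 0 ∧ (i : ℕ) = 2) ∨
     ((i : ℕ) = 1 ∧ (j : ℕ) = 2) ∨ ((j : ℕ) = 1 ∧ (i : ℕ) = 2) ∨
     (2 ≤ (i : ℕ) ∧ (i : ℕ) + 1 = (j : ℕ)) ∨ (2 ≤ (j : ℕ) ∧ (j : ℕ) + 1 = (i : ℕ))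
  then 1 else 0

def edgeE (n : ℕ) : Fin n → Fin n → ℕ := fun i j =>
  if ((i : ℕ) + 1 = (j : ℕ) ∧ (j : ℕ) ≤ n - 2) ∨ ((j : ℕ) + 1 = (i : ℕ) ∧ (i : ℕ) ≤ n - 2) ∨
     ((i : ℕ) = 2 ∧ (j : ℕ) = n - 1) ∨ ((j : ℕ) = 2 ∧ (i : ℕ) = n - 1)
  then 1 else 0

/-- The underlying graph (given by its edge-count function `E`) is a Dynkin diagram of
type `A`, `D`, or `E`. -/
def IsDynkinADE (n : ℕ) (E : Fin n → Fin n → ℕ) : Prop :=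
  ∃ e : Fin n ≃ Fin n,
    (∀ i j, E i j = edgeA n (e i) (e j)) ∨
    (4 ≤ n ∧ ∀ i j, E i j = edgeD n (e i) (e j)) ∨
    ((n = 6 ∨ n = 7 ∨ n = 8) ∧ ∀ i j, E i j = edgeE n (e i) (e j))

/-! ## Coxeter-sortable elements -/

/-- Lexicographic comparison of index tuples. -/
def lexLE {s : ℕ} (ι ι' : Fin s → ℕ) : Prop :=
  ι = ι' ∨ ∃ j, (∀ j', j' < j → ι j' = ι' j') ∧ ι j < ι' j

/-- `w` is `c`-sortable for the Coxeter element determined by the half-infinite word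
`cseq` (with dividers every `blockLen` letters): the lexicographically first subsequence
of `cseq` that is a reduced word for `w` defines a sequence of subsets (between adjacent
dividers) that is decreasing under inclusion. -/
def CSortable (A : Fin n → Fin n → ℤ) (hA : ∀ i, A i i = 2) (cseq : ℕ → Fin n)
    (blockLen : ℕ) (w : (Fin n → ℤ) ≃ₗ[ℤ] (Fin n → ℤ)) : Prop :=
  ∃ (s : ℕ) (ι : Fin s → ℕ), StrictMono ι ∧
    w = ((List.ofFn fun j => cseq (ι j)).map (sigmaE A hA)).prod ∧
    wordLen A hA w = s ∧
    (∀ ι' : Fin s → ℕ, StrictMono ι' →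
      w = ((List.ofFn fun j => cseq (ι' j)).map (sigmaE A hA)).prod → lexLE ι ι') ∧
    ∀ m : ℕ, {a : Fin n | ∃ j, (ι j) / blockLen = m + 1 ∧ cseq (ι j) = a} ⊆
             {a : Fin n | ∃ j, (ι j) / blockLen = m ∧ cseq (ι j) = a}


/-- A nonzero non-isomorphism between representations. -/
def RepStep {k : Type} [Field k] {n : ℕ} {Λ : Fin n → Fin n → ℕ} (X Y : Rep k n Λ) : Prop :=
  ∃ f : RepHom X Y, (∃ x v, f.g x v ≠ 0) ∧ ¬ ∀ x, Function.Bijective (f.g x)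

/-- `v` is a minimal element of `D` in the poset `(Γ₀, Λ)`. -/
def MinimalIn {n : ℕ} (Λ : Fin n → Fin n → ℕ) (D : Set (Fin n)) (v : Fin n) : Prop :=
  v ∈ D ∧ ∀ u ∈ D, PathLE Λ u v → u = v

/-- The pairs `(h, v)` of Proposition 3.2(a): `0 < h ≤ r` and `v` a minimal element of
`Supp S_h \ H_Λ(Supp S_{h+1})` (with `Supp S_{r+1} = ∅`). -/
def JoinPair {n : ℕ} (Λ : Fin n → Fin n → ℕ) (segs : List (List (Fin n)))
    (p : ℕ × Fin n) : Prop :=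
  0 < p.1 ∧ p.1 ≤ segs.length ∧
  MinimalIn Λ (suppOf (segs.getD (p.1 - 1) []) \ hull Λ (suppOf (segs.getD p.1 []))) p.2

/-! ## Part 1: words in the Weyl group and positivity of roots -/

section Coxeter

/-- the `i`-th coroot functional -/
def cf {n : ℕ} (A : Fin n → Fin n → ℤ) (i : Fin n) (v : Fin n → ℤ) : ℤ := ∑ l, A i l * v l

lemma sigmaL_apply {n : ℕ} (A : Fin n → Fin n → ℤ) (i : Fin n) (v : Fin n → ℤ) :
    sigmaL A i v = v - cf A i v • Pi.single i 1 := rfl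

lemma cf_sub {n : ℕ} (A : Fin n → Fin n → ℤ) (i j : Fin n) (v : Fin n → ℤ) (t : ℤ) :
    cf A i (v - t • Pi.single j 1) = cf A i v - t * A i j := by
  unfold cf
  simp only [Pi.sub_apply, Pi.smul_apply, smul_eq_mul, mul_sub, Finset.sum_sub_distrib]
  congr 1
  rw [Finset.sum_eq_single j]
  · simp; ring
  · intro b _ hb
    simp [Pi.single_eq_of_ne hb]
  · simp

lemma cf_single {n : ℕ} (A : Fin n → Fin n → ℤ) (i j : Fin n) :
    cf A i (Pi.single j 1) = A i j := by
  unfold cf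
  rw [Finset.sum_eq_single j]
  · simp
  · intro b _ hb
    simp [Pi.single_eq_of_ne hb]
  · simp

lemma sigmaL_single {n : ℕ} (A : Fin n → Fin n → ℤ) (i j : Fin n) :
    sigmaL A i (Pi.single j 1) = Pi.single j 1 - A i j • Pi.single i 1 := by
  rw [sigmaL_apply, cf_single]

lemma sigmaE_apply {n : ℕ} (A : Fin n → Fin n → ℤ) (hA : ∀ i, A i i = 2) (i : Fin n)
    (v : Fin n → ℤ) : sigmaE A hA i v = sigmaL A i v := rfl

lemma sigmaL_sigmaL {n : ℕ} (A : Fin n → Fin n → ℤ) (hA : ∀ i, A i i = 2) (i : Fin n)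
    (v : Fin n → ℤ) : sigmaL A i (sigmaL A i v) = v :=
  LinearMap.congr_fun (sigma_invol A hA i) v

lemma sigmaE_mul_self {n : ℕ} (A : Fin n → Fin n → ℤ) (hA : ∀ i, A i i = 2) (i : Fin n) :
    sigmaE A hA i * sigmaE A hA i = 1 := by
  ext1 v
  exact sigmaL_sigmaL A hA i v

lemma braid2 {n : ℕ} (A : Fin n → Fin n → ℤ) (hA : ∀ i, A i i = 2) (i j : Fin n)
    (h1 : A i j = 0) (h2 : A j i = 0) :
    sigmaE A hA i * (sigmaE A hA j * sigmaE A hA i) = sigmaE A hA j := by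
  ext1 v
  simp only [LinearEquiv.mul_apply, sigmaE_apply, sigmaL_apply, cf_sub, h1, h2, hA]
  module

lemma braid3 {n : ℕ} (A : Fin n → Fin n → ℤ) (hA : ∀ i, A i i = 2) (i j : Fin n)
    (h1 : A i j = -1) (h2 : A j i = -1) :
    sigmaE A hA j * (sigmaE A hA i * (sigmaE A hA j * sigmaE A hA i)) =
      sigmaE A hA i * sigmaE A hA j := by
  ext1 v
  simp only [LinearEquiv.mul_apply, sigmaE_apply, sigmaL_apply, cf_sub, h1, h2, hA]
  module

/-- product of the simple reflections of a word -/
def prd {n : ℕ} (A : Fin n → Fin n → ℤ) (hA : ∀ i, A i i = 2) (ys : List (Fin n)) :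
    (Fin n → ℤ) ≃ₗ[ℤ] (Fin n → ℤ) := (ys.map (sigmaE A hA)).prod

lemma prd_nil {n : ℕ} (A : Fin n → Fin n → ℤ) (hA : ∀ i, A i i = 2) : prd A hA [] = 1 := rfl

lemma prd_append {n : ℕ} (A : Fin n → Fin n → ℤ) (hA : ∀ i, A i i = 2) (a b : List (Fin n)) :
    prd A hA (a ++ b) = prd A hA a * prd A hA b := by simp [prd]

lemma prd_cons {n : ℕ} (A : Fin n → Fin n → ℤ) (hA : ∀ i, A i i = 2) (a : Fin n)
    (b : List (Fin n)) : prd A hA (a :: b) = sigmaE A hA a * prd A hA b := by simp [prd]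

lemma prd_single {n : ℕ} (A : Fin n → Fin n → ℤ) (hA : ∀ i, A i i = 2) (a : Fin n) :
    prd A hA [a] = sigmaE A hA a := by simp [prd]

lemma len_le {n : ℕ} (A : Fin n → Fin n → ℤ) (hA : ∀ i, A i i = 2) (ys : List (Fin n)) :
    wordLen A hA (prd A hA ys) ≤ ys.length := Nat.sInf_le ⟨ys, rfl, rfl⟩

lemma exists_red {n : ℕ} (A : Fin n → Fin n → ℤ) (hA : ∀ i, A i i = 2) (ys : List (Fin n)) :
    ∃ zs : List (Fin n), prd A hA zs = prd A hA ys ∧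
      zs.length = wordLen A hA (prd A hA ys) := by
  have h : {l | ∃ zs : List (Fin n), zs.length = l ∧
    prd A hA ys = (zs.map (sigmaE A hA)).prod}.Nonempty := ⟨_, ys, rfl, rfl⟩
  obtain ⟨zs, h1, h2⟩ := Nat.sInf_mem h
  exact ⟨zs, h2.symm, h1⟩

lemma len_mul_le {n : ℕ} (A : Fin n → Fin n → ℤ) (hA : ∀ i, A i i = 2) (a b : List (Fin n)) :
    wordLen A hA (prd A hA a * prd A hA b) ≤ wordLen A hA (prd A hA a) + b.length := by
  obtain ⟨zs, h1, h2⟩ := exists_red A hA a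
  rw [← h2, ← h1, ← prd_append]
  simpa using len_le A hA (zs ++ b)

lemma not_chain {α : Type} (l : List α) (h : ¬ l.IsChain (· ≠ ·)) :
    ∃ l1 a l2, l = l1 ++ a :: a :: l2 := by
  classical
  induction l with
  | nil => simp at h
  | cons x xs ih =>
    cases xs with
    | nil => simp at h
    | cons y ys =>
      by_cases hxy : x = y
      · exact ⟨[], x, ys, by simp [hxy]⟩
      · have : ¬ (y :: ys).IsChain (· ≠ ·) := fun h' => h (by simp [List.isChain_cons_cons, hxy, h'])
        obtain ⟨l1, a, l2, e⟩ := ih this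
        exact ⟨x :: l1, a, l2, by rw [e]; rfl⟩

lemma rank2_big {n : ℕ} (A : Fin n → Fin n → ℤ) (hA : ∀ i, A i i = 2) (i j : Fin n)
    (h1 : A i j ≤ -2) (h2 : A j i ≤ -2) (us : List (Fin n))
    (hus : ∀ z ∈ us, z = i ∨ z = j) (hc : (us ++ [i]).IsChain (· ≠ ·)) :
    ((us ++ [i]).head? = some i ∧ ∃ α β : ℤ, 0 ≤ β ∧ β ≤ α ∧
      prd A hA us (Pi.single i 1) = α • Pi.single i 1 + β • Pi.single j 1) ∨
    ((us ++ [i]).head? = some j ∧ ∃ α β : ℤ, 0 ≤ β ∧ β ≤ α ∧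
      prd A hA us (Pi.single i 1) = α • Pi.single j 1 + β • Pi.single i 1) := by
  induction us with
  | nil =>
    left
    refine ⟨rfl, 1, 0, by simp, by simp, by simp [prd_nil]⟩
  | cons z us ih =>
    have hc' : (us ++ [i]).IsChain (· ≠ ·) := by
      have := hc.tail
      simpa using this
    have hz : ∀ w, (us ++ [i]).head? = some w → z ≠ w := by
      intro w hw
      cases hl : us ++ [i] with
      | nil => simp at hl
      | cons a b =>
        rw [hl] at hw
        rw [List.cons_append, hl] at hc
        simp at hw
        subst hw
        exact (List.isChain_cons_cons.1 hc).1
    rcases ih (fun w hw => hus w (by simp [hw])) hc' with ⟨h, α, β, hb, ha, e⟩ | ⟨h, α, β, hb, ha, e⟩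
    · have hzj : z = j := (hus z (by simp)).resolve_left (hz i h)
      subst hzj
      right
      refine ⟨rfl, -(A z i) * α - β, α, by linarith, by nlinarith, ?_⟩
      rw [prd_cons, LinearEquiv.mul_apply, e, sigmaE_apply, map_add, map_smul, map_smul,
        sigmaL_single, sigmaL_single, hA]
      module
    · have hzi : z = i := (hus z (by simp)).resolve_right (hz j h)
      subst hzi
      left
      refine ⟨rfl, -(A z j) * α - β, α, by linarith, by nlinarith, ?_⟩
      rw [prd_cons, LinearEquiv.mul_apply, e, sigmaE_apply, map_add, map_smul, map_smul,
        sigmaL_single, sigmaL_single, hA]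
      module

lemma rank2 {n : ℕ} (A : Fin n → Fin n → ℤ) (hA : ∀ i, A i i = 2) (i j : Fin n)
    (hsym : A j i = A i j) (hneg : A i j ≤ 0) (us : List (Fin n))
    (hus : ∀ z ∈ us, z = i ∨ z = j)
    (hmin : ∀ us' : List (Fin n), 
      prd A hA us' = prd A hA (us ++ [i]) → us.length ≤ us'.length ∨ ∃ z ∈ us', ¬ (z = i ∨ z = j)) :
    ∃ α β : ℤ, 0 ≤ α ∧ 0 ≤ β ∧
      prd A hA us (Pi.single i 1) = α • Pi.single i 1 + β • Pi.single j 1 := by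
  have hus1 : ∀ z ∈ us ++ [i], z = i ∨ z = j := by
    intro z hz
    rcases List.mem_append.1 hz with h | h
    · exact hus z h
    · left; simpa using h
  have hc : (us ++ [i]).IsChain (· ≠ ·) := by
    by_contra h
    obtain ⟨l1, a, l2, e⟩ := not_chain _ h
    have hl := congrArg List.length e
    simp at hl
    rcases hmin (l1 ++ l2) (by
      rw [e, prd_append, prd_append, prd_cons, prd_cons, ← mul_assoc (sigmaE A hA a),
        sigmaE_mul_self, one_mul]) with h | ⟨z, hz, h⟩
    · simp at h; omega
    · apply h
      apply hus1
      rw [e]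
      simp at hz ⊢
      tauto
  have h3 : A i j = 0 ∨ A i j = -1 ∨ A i j ≤ -2 := by omega
  rcases List.eq_nil_or_concat us with rfl | ⟨u1, y1, rfl⟩
  · exact ⟨1, 0, by simp, by simp, by simp [prd_nil]⟩
  rw [List.concat_eq_append] at *
  have hy1 : y1 = j := by
    refine (hus y1 (by simp)).resolve_left ?_
    rintro rfl
    rw [List.append_assoc] at hc
    have := (List.isChain_append.1 hc).2.1
    simp at this
  rw [hy1] at hus hmin hus1 hc ⊢
  clear hy1
  rcases List.eq_nil_or_concat u1 with rfl | ⟨u2, y2, rfl⟩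
  · refine ⟨1, - A i j, by simp, by linarith, ?_⟩
    rw [List.nil_append, prd_single, sigmaE_apply, sigmaL_single, hsym]
    module
  rw [List.concat_eq_append] at *
  have hij : j ≠ i := by
    rw [List.append_assoc] at hc
    have := (List.isChain_append.1 hc).2.1
    simpa using this
  have hy2 : y2 = i := by
    refine (hus y2 (by simp)).resolve_right ?_
    rintro rfl
    rw [List.append_assoc, List.append_assoc] at hc
    have := (List.isChain_append.1 hc).2.1
    simp at this
  rw [hy2] at hus hmin hus1 hc ⊢
  clear hy2
  rcases h3 with h3 | h3 | h3
  · exfalso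
    rcases hmin (u2 ++ [j]) (by
      simp only [prd_append, prd_single, mul_assoc]
      rw [braid2 A hA i j h3 (by omega)]) with h | ⟨z, hz, h⟩
    · simp at h
    · apply h
      apply hus
      simp at hz ⊢
      tauto
  · rcases List.eq_nil_or_concat u2 with rfl | ⟨u3, y3, rfl⟩
    · refine ⟨0, 1, by simp, by simp, ?_⟩
      rw [List.nil_append, List.singleton_append, prd_cons, prd_single, LinearEquiv.mul_apply,
        sigmaE_apply, sigmaE_apply, sigmaL_single, map_sub, map_smul, sigmaL_single, sigmaL_single,
        hsym, h3, hA]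
      module
    · exfalso
      rw [List.concat_eq_append] at *
      have hy3 : y3 = j := by
        refine (hus y3 (by simp)).resolve_left ?_
        rintro rfl
        rw [List.append_assoc, List.append_assoc, List.append_assoc] at hc
        have := (List.isChain_append.1 hc).2.1
        simp at this
      subst hy3
      rcases hmin (u3 ++ [i, y3]) (by
        simp only [prd_append, prd_cons, prd_nil, mul_assoc, mul_one]
        rw [braid3 A hA i y3 h3 (by omega)]) with h | ⟨z, hz, h⟩
      · simp at h
      · apply h
        apply hus
        simp at hz ⊢
        tauto
  · rcases rank2_big A hA i j h3 (by omega) _ hus hc with ⟨-, α, β, hb, ha, e⟩ | ⟨-, α, β, hb, ha, e⟩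
    · exact ⟨α, β, by linarith, hb, e⟩
    · exact ⟨β, α, hb, by linarith, by rw [e, add_comm]⟩

theorem pos_of_len {n : ℕ} (A : Fin n → Fin n → ℤ) (hA : ∀ i, A i i = 2)
    (hsym : ∀ i j, A j i = A i j) (hneg : ∀ i j, i ≠ j → A i j ≤ 0) (m : ℕ) :
    ∀ (ys : List (Fin n)), wordLen A hA (prd A hA ys) = m → ∀ i,
      m ≤ wordLen A hA (prd A hA (ys ++ [i])) → 0 ≤ prd A hA ys (Pi.single i 1) := by
  classical
  induction m using Nat.strong_induction_on with
  | _ m IH =>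
  intro ys hm i hi
  obtain ⟨zs, hz1, hz2⟩ := exists_red A hA ys
  rw [hm] at hz2
  rw [prd_append] at hi
  rw [← hz1] at hm hi ⊢
  rcases List.eq_nil_or_concat zs with rfl | ⟨w, j, rfl⟩
  · simp [prd_nil]
  rw [List.concat_eq_append] at *
  simp only [List.length_append, List.length_singleton] at hz2
  have hij : i ≠ j := by
    rintro rfl
    rw [prd_append, prd_single, mul_assoc, sigmaE_mul_self, mul_one] at hi
    have := len_le A hA w
    omega
  have hex : ∃ q, ∃ vs us : List (Fin n), (∀ z ∈ us, z = i ∨ z = j) ∧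
      prd A hA vs * prd A hA us = prd A hA (w ++ [j]) ∧
      wordLen A hA (prd A hA vs) + us.length ≤ m ∧ us ≠ [] ∧ wordLen A hA (prd A hA vs) = q := by
    refine ⟨_, w, [j], by simp, by rw [prd_append], ?_, by simp, rfl⟩
    have := len_le A hA w
    simp; omega
  obtain ⟨vs, us, hus, he, hl, hne, hq⟩ := Nat.find_spec hex
  have hmin := fun q (hq : q < Nat.find hex) => Nat.find_min hex hq
  set q := Nat.find hex with hqdef
  have hpos : 0 < us.length := List.length_pos_iff.2 hne
  have hstep : ∀ a, (a = i ∨ a = j) → 0 ≤ prd A hA vs (Pi.single a 1) := by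
    intro a ha
    apply IH q (by omega) vs hq a
    by_contra hlt
    push Not at hlt
    refine hmin _ hlt ⟨vs ++ [a], a :: us, ?_, ?_, ?_, by simp, rfl⟩
    · intro z hz
      rcases List.mem_cons.1 hz with rfl | h
      · exact ha
      · exact hus z h
    · rw [prd_append, prd_single, prd_cons, mul_assoc, ← mul_assoc (sigmaE A hA a),
        sigmaE_mul_self, one_mul, he]
    · simp only [List.length_cons]
      omega
  obtain ⟨α, β, ha, hb, e⟩ := rank2 A hA i j (hsym i j) (hneg i j hij) us hus (by
    intro us' h'
    left
    have h1 := len_mul_le A hA vs us'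
    rw [h', prd_append, ← mul_assoc, he] at h1
    omega)
  rw [← he, LinearEquiv.mul_apply, e, map_add, map_smul, map_smul]
  exact add_nonneg (smul_nonneg ha (hstep i (Or.inl rfl))) (smul_nonneg hb (hstep j (Or.inr rfl)))

lemma prd_twice {n : ℕ} (A : Fin n → Fin n → ℤ) (hA : ∀ i, A i i = 2) (S : List (Fin n))
    (i : Fin n) : prd A hA (S ++ [i] ++ [i]) = prd A hA S := by
  rw [prd_append, prd_append, prd_single, mul_assoc, sigmaE_mul_self, mul_one]

/-- roots are positive or negative -/
theorem root_dichotomy {n : ℕ} (A : Fin n → Fin n → ℤ) (hA : ∀ i, A i i = 2)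
    (hsym : ∀ i j, A j i = A i j) (hneg : ∀ i j, i ≠ j → A i j ≤ 0) 
    (ys : List (Fin n)) (i : Fin n) :
    0 ≤ prd A hA ys (Pi.single i 1) ∨ prd A hA ys (Pi.single i 1) ≤ 0 := by
  rcases le_total (wordLen A hA (prd A hA ys)) (wordLen A hA (prd A hA (ys ++ [i]))) with h | h
  · exact Or.inl (pos_of_len A hA hsym hneg _ ys rfl i h)
  · right
    have := pos_of_len A hA hsym hneg _ (ys ++ [i]) rfl i (by
      rwa [prd_twice])
    rw [prd_append, prd_single, LinearEquiv.mul_apply, sigmaE_apply, sigmaL_single, hA, map_sub,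
      map_smul] at this
    intro l
    have := this l
    simp at this ⊢
    linarith

/-- positivity of all the partial roots implies reducedness -/
theorem len_eq_of_pos {n : ℕ} (A : Fin n → Fin n → ℤ) (hA : ∀ i, A i i = 2)
    (hsym : ∀ i j, A j i = A i j) (hneg : ∀ i j, i ≠ j → A i j ≤ 0) 
    (S : List (Fin n)) (h : ∀ P x Q, S = P ++ x :: Q → 0 ≤ prd A hA P (Pi.single x 1)) :
    wordLen A hA (prd A hA S) = S.length := by
  induction S using List.reverseRecOn with
  | nil =>
    have := len_le A hA []
    simpa using this
  | append_singleton S i ih =>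
    have ih' := ih (fun P x Q e => h P x (Q ++ [i]) (by rw [e]; simp))
    have hp := h S i [] rfl
    apply le_antisymm (len_le _ _ _)
    by_contra hlt
    simp only [List.length_append, List.length_singleton] at hlt
    have := pos_of_len A hA hsym hneg _ (S ++ [i]) rfl i (by
      rw [prd_twice, ih']
      omega)
    rw [prd_append, prd_single, LinearEquiv.mul_apply, sigmaE_apply, sigmaL_single, hA, map_sub,
      map_smul] at this
    have h0 : prd A hA S (Pi.single i 1) = 0 := by
      funext l
      have h1 := this l
      have h2 := hp l
      simp at h1 h2 ⊢
      linarith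
    have := congrFun ((LinearEquiv.map_eq_zero_iff _).1 h0) i
    simp at this

lemma prd_reverse {n : ℕ} (A : Fin n → Fin n → ℤ) (hA : ∀ i, A i i = 2) (S : List (Fin n)) :
    prd A hA S.reverse = (prd A hA S)⁻¹ := by
  induction S with
  | nil => simp [prd_nil]
  | cons a S ih =>
    rw [List.reverse_cons, prd_append, ih, prd_single, prd_cons, mul_inv_rev]
    rw [inv_eq_of_mul_eq_one_right (sigmaE_mul_self A hA a)]

lemma len_reverse {n : ℕ} (A : Fin n → Fin n → ℤ) (hA : ∀ i, A i i = 2) (S : List (Fin n)) :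
    wordLen A hA (prd A hA S.reverse) = wordLen A hA (prd A hA S) := by
  have key : ∀ T, wordLen A hA (prd A hA T.reverse) ≤ wordLen A hA (prd A hA T) := by
    intro T
    obtain ⟨zs, h1, h2⟩ := exists_red A hA T
    rw [← h2, prd_reverse, ← h1, ← prd_reverse]
    simpa using len_le A hA zs.reverse
  apply le_antisymm (key S)
  simpa using key S.reverse

end Coxeter

/-! ## Part 2: combinatorics of admissible sequences and the Euler form -/

section Comb

lemma edges_flip {n : ℕ} (x : Fin n) (Λ : Fin n → Fin n → ℕ) : edges (flipO x Λ) = edges Λ := by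
  funext a b
  unfold edges flipO
  by_cases h : a = x ∨ b = x
  · simp only [h, h.symm, if_true]; omega
  · have h' : ¬ (b = x ∨ a = x) := fun q => h q.symm
    simp only [h, h', if_false]

lemma cartan_flip {n : ℕ} (x : Fin n) (Λ : Fin n → Fin n → ℕ) :
    cartanOf (flipO x Λ) = cartanOf Λ := by
  unfold cartanOf
  rw [edges_flip]

lemma flip_loop {n : ℕ} (x : Fin n) (Λ : Fin n → Fin n → ℕ) (h : ∀ a, Λ a a = 0) (a : Fin n) :
    flipO x Λ a a = 0 := by
  simp [flipO, h]

lemma cartan_sym {n : ℕ} (Λ : Fin n → Fin n → ℕ) (i j : Fin n) :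
    cartanOf Λ j i = cartanOf Λ i j := by
  unfold cartanOf edges
  by_cases h : i = j
  · simp [h]
  · simp [h, Ne.symm h, add_comm]

lemma cartan_neg {n : ℕ} (Λ : Fin n → Fin n → ℕ) (i j : Fin n) (h : i ≠ j) :
    cartanOf Λ i j ≤ 0 := by
  unfold cartanOf
  simp only [h, if_false]
  omega

lemma adm_append {n : ℕ} (P Q : List (Fin n)) (Λ : Fin n → Fin n → ℕ) :
    Admissible Λ (P ++ Q) ↔ Admissible Λ P ∧ Admissible (orientAfter Λ P) Q := by
  induction P generalizing Λ with
  | nil => simp [Admissible, orientAfter]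
  | cons x P ih => simp [Admissible, orientAfter, ih, and_assoc]

lemma orient_append {n : ℕ} (P Q : List (Fin n)) (Λ : Fin n → Fin n → ℕ) :
    orientAfter Λ (P ++ Q) = orientAfter (orientAfter Λ P) Q := by
  induction P generalizing Λ with
  | nil => rfl
  | cons x P ih => simp [orientAfter, ih]

lemma edges_orient {n : ℕ} (P : List (Fin n)) (Λ : Fin n → Fin n → ℕ) :
    edges (orientAfter Λ P) = edges Λ := by
  induction P generalizing Λ with
  | nil => rfl
  | cons x P ih => rw [orientAfter, ih, edges_flip]

lemma cartan_orient {n : ℕ} (P : List (Fin n)) (Λ : Fin n → Fin n → ℕ) :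
    cartanOf (orientAfter Λ P) = cartanOf Λ := by
  unfold cartanOf
  rw [edges_orient]

lemma orient_loop {n : ℕ} (P : List (Fin n)) (Λ : Fin n → Fin n → ℕ) (h : ∀ a, Λ a a = 0) :
    ∀ a, orientAfter Λ P a a = 0 := by
  induction P generalizing Λ with
  | nil => exact h
  | cons x P ih => exact ih _ (flip_loop x Λ h)

/-- The Euler form -/
def euler {n : ℕ} (Λ : Fin n → Fin n → ℕ) (u v : Fin n → ℤ) : ℤ :=
  ∑ a, u a * (v a - ∑ b, (Λ a b : ℤ) * v b)

lemma euler_add_left {n : ℕ} (Λ : Fin n → Fin n → ℕ) (u u' v : Fin n → ℤ) :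
    euler Λ (u + u') v = euler Λ u v + euler Λ u' v := by
  simp [euler, add_mul, Finset.sum_add_distrib]

lemma euler_smul_left {n : ℕ} (Λ : Fin n → Fin n → ℕ) (t : ℤ) (u v : Fin n → ℤ) :
    euler Λ (t • u) v = t * euler Λ u v := by
  simp [euler, mul_assoc, Finset.mul_sum]

lemma euler_add_right {n : ℕ} (Λ : Fin n → Fin n → ℕ) (u v v' : Fin n → ℤ) :
    euler Λ u (v + v') = euler Λ u v + euler Λ u v' := by
  simp only [euler, ← Finset.sum_add_distrib]
  refine Finset.sum_congr rfl fun a _ => ?_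
  simp only [Pi.add_apply, mul_add, Finset.sum_add_distrib]
  ring

lemma euler_smul_right {n : ℕ} (Λ : Fin n → Fin n → ℕ) (t : ℤ) (u v : Fin n → ℤ) :
    euler Λ u (t • v) = t * euler Λ u v := by
  simp only [euler, Finset.mul_sum]
  refine Finset.sum_congr rfl fun a _ => ?_
  have : ∑ b, (Λ a b : ℤ) * (t • v) b = t * ∑ b, (Λ a b : ℤ) * v b := by
    rw [Finset.mul_sum]
    exact Finset.sum_congr rfl fun b _ => by simp; ring
  rw [this]
  simp
  ring

lemma euler_single_left {n : ℕ} (Λ : Fin n → Fin n → ℕ) (x : Fin n) (v : Fin n → ℤ) :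
    euler Λ (Pi.single x 1) v = v x - ∑ b, (Λ x b : ℤ) * v b := by
  unfold euler
  rw [Finset.sum_eq_single x]
  · simp
  · intro b _ hb
    simp [Pi.single_eq_of_ne hb]
  · simp

/-- incoming sum -/
def inS {n : ℕ} (Λ : Fin n → Fin n → ℕ) (x : Fin n) (u : Fin n → ℤ) : ℤ :=
  ∑ a, (Λ a x : ℤ) * u a

lemma euler_single_right {n : ℕ} (Λ : Fin n → Fin n → ℕ) (x : Fin n) (u : Fin n → ℤ) :
    euler Λ u (Pi.single x 1) = u x - inS Λ x u := by
  unfold euler inS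
  have : ∀ a, u a * ((Pi.single x 1 : Fin n → ℤ) a - ∑ b, (Λ a b : ℤ) * (Pi.single x 1 : Fin n → ℤ) b)
      = u a * (Pi.single x 1 : Fin n → ℤ) a - (Λ a x : ℤ) * u a := by
    intro a
    rw [Finset.sum_eq_single x]
    · simp; ring
    · intro b _ hb
      simp [Pi.single_eq_of_ne hb]
    · simp
  rw [Finset.sum_congr rfl fun a _ => this a, Finset.sum_sub_distrib]
  congr 1
  rw [Finset.sum_eq_single x]
  · simp
  · intro b _ hb
    simp [Pi.single_eq_of_ne hb]
  · simp

lemma cf_sink {n : ℕ} (Λ : Fin n → Fin n → ℕ) (x : Fin n) (hx : IsSink Λ x) (u : Fin n → ℤ) :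
    cf (cartanOf Λ) x u = 2 * u x - inS Λ x u := by
  unfold cf inS
  have : ∀ l, cartanOf Λ x l * u l = 2 * (u l * (Pi.single x 1 : Fin n → ℤ) l) - (Λ l x : ℤ) * u l := by
    intro l
    by_cases h : x = l
    · subst h
      simp [cartanOf, hx x]
    · simp [cartanOf, h, edges, hx l]
  rw [Finset.sum_congr rfl fun a _ => this a, Finset.sum_sub_distrib]
  congr 1
  rw [Finset.sum_eq_single x]
  · simp
  · intro b _ hb
    simp [Pi.single_eq_of_ne hb]
  · simp

lemma euler_flip {n : ℕ} (Λ : Fin n → Fin n → ℕ) (x : Fin n) (hx : IsSink Λ x)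
    (u v : Fin n → ℤ) :
    euler (flipO x Λ) u v = euler Λ u v - u x * inS Λ x v + v x * inS Λ x u := by
  have key : ∀ a, u a * (v a - ∑ b, (flipO x Λ a b : ℤ) * v b) =
      u a * (v a - ∑ b, (Λ a b : ℤ) * v b) - (Pi.single x 1 : Fin n → ℤ) a * (u x * inS Λ x v)
        + v x * ((Λ a x : ℤ) * u a) := by
    intro a
    by_cases h : a = x
    · subst h
      have h1 : ∀ b, (flipO a Λ a b : ℤ) = Λ b a := by intro b; simp [flipO]
      have h2 : ∀ b, (Λ a b : ℤ) = 0 := by intro b; simp [hx b]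
      simp only [h1, h2, inS]
      simp
      ring
    · have h1 : ∀ b, (flipO x Λ a b : ℤ) * v b =
          (Λ a b : ℤ) * v b - (Pi.single x 1 : Fin n → ℤ) b * ((Λ a x : ℤ) * v x) := by
        intro b
        by_cases hb : b = x
        · subst hb; simp [flipO, hx a]
        · simp [flipO, h, hb]
      rw [Finset.sum_congr rfl fun b _ => h1 b, Finset.sum_sub_distrib, ← Finset.sum_mul]
      simp [Pi.single_eq_of_ne h]
      ring
  unfold euler
  rw [Finset.sum_congr rfl fun a _ => key a, Finset.sum_add_distrib, Finset.sum_sub_distrib,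
    ← Finset.sum_mul, ← Finset.mul_sum]
  simp [inS]

lemma inS_add {n : ℕ} (Λ : Fin n → Fin n → ℕ) (x : Fin n) (hx : Λ x x = 0) (u : Fin n → ℤ) (t : ℤ) :
    inS Λ x (u + t • Pi.single x 1) = inS Λ x u := by
  unfold inS
  refine Finset.sum_congr rfl fun a _ => ?_
  by_cases h : a = x
  · subst h; simp [hx]
  · simp [Pi.single_eq_of_ne h]

lemma euler_reflect {n : ℕ} (Λ : Fin n → Fin n → ℕ) (x : Fin n) (hx : IsSink Λ x)
    (u v : Fin n → ℤ) :
    euler (flipO x Λ) (sigmaL (cartanOf Λ) x u) (sigmaL (cartanOf Λ) x v) = euler Λ u v := by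
  rw [euler_flip Λ x hx]
  have h : ∀ u, sigmaL (cartanOf Λ) x u = u + (inS Λ x u - 2 * u x) • Pi.single x 1 := by
    intro u
    rw [sigmaL_apply, cf_sink Λ x hx]
    module
  have h0 : ∀ v : Fin n → ℤ, euler Λ (Pi.single x 1) v = v x := by
    intro v
    rw [euler_single_left]
    simp [hx _]
  rw [h, h, inS_add _ _ (hx x), inS_add _ _ (hx x)]
  simp only [euler_add_left, euler_add_right, euler_smul_left, euler_smul_right, h0,
    euler_single_right, inS_add Λ x (hx x), Pi.add_apply, Pi.smul_apply, Pi.single_eq_same, smul_eq_mul, mul_one]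
  ring

lemma euler_act {n : ℕ} (A : Fin n → Fin n → ℤ) (hA : ∀ i, A i i = 2) (T : List (Fin n)) 
    (u v : Fin n → ℤ) : ∀ (Λ : Fin n → Fin n → ℕ), cartanOf Λ = A → Admissible Λ T →
    euler Λ (prd A hA T u) (prd A hA T v) = euler (orientAfter Λ T) u v := by
  induction T with
  | nil => intro Λ _ _; rfl
  | cons t T ih =>
    intro Λ hΛ hT
    rw [orientAfter, ← ih (flipO t Λ) (by rw [cartan_flip, hΛ]) hT.2, prd_cons,
      LinearEquiv.mul_apply, LinearEquiv.mul_apply, sigmaE_apply, sigmaE_apply,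
      ← euler_reflect Λ t hT.1, hΛ, sigmaL_sigmaL A hA, sigmaL_sigmaL A hA]

lemma sigmaL_coord_ne {n : ℕ} (A : Fin n → Fin n → ℤ) (z b : Fin n) (h : b ≠ z) (v : Fin n → ℤ) :
    sigmaL A z v b = v b := by
  rw [sigmaL_apply]
  simp [Pi.single_eq_of_ne h]

/-- If `v` stays nonnegative and pairs positively with `e_x`, so the root of `x` stays positive. -/
lemma pos_of_pair {n : ℕ} (A : Fin n → Fin n → ℤ) (hA : ∀ i, A i i = 2)
    (hsym : ∀ i j, A j i = A i j) (hneg : ∀ i j, i ≠ j → A i j ≤ 0) (x : Fin n) (v : Fin n → ℤ)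
    (hv : 0 < v x) (T : List (Fin n)) : ∀ (Λ : Fin n → Fin n → ℕ), cartanOf Λ = A →
      Admissible Λ T → IsSink (orientAfter Λ T) x →
      (∀ T0, T0 <:+ T → 0 ≤ prd A hA T0 v) → 0 ≤ prd A hA T (Pi.single x 1) := by
  induction T with
  | nil => intro Λ _ _ _ _; simp [prd_nil]
  | cons z T ih =>
    intro Λ hΛ hT hx hpos
    have h1 := ih (flipO z Λ) (by rw [cartan_flip, hΛ]) hT.2 hx
      (fun T0 h => hpos T0 (h.trans (List.suffix_cons z T)))
    rcases root_dichotomy A hA hsym hneg (z :: T) x with h2 | h2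
    · exact h2
    exfalso
    set u := prd A hA T (Pi.single x 1) with hu
    rw [prd_cons, LinearEquiv.mul_apply, sigmaE_apply, ← hu] at h2
    have hE := euler_act A hA T (Pi.single x 1) v (flipO z Λ) (by rw [cartan_flip, hΛ]) hT.2
    rw [← hu] at hE
    have hx' : IsSink (orientAfter (flipO z Λ) T) x := hx
    rw [euler_single_left] at hE
    simp only [hx' _] at hE
    simp only [Nat.cast_zero, zero_mul, Finset.sum_const_zero, sub_zero] at hE
    have hu2 : u = u z • Pi.single z 1 := by
      funext b
      by_cases hb : b = z
      · subst hb; simp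
      · have h3 := h2 b
        rw [sigmaL_coord_ne _ _ _ hb] at h3
        have h4 := h1 b
        simp [Pi.single_eq_of_ne hb] at h3 h4 ⊢
        linarith
    rw [hu2, euler_smul_left, euler_single_left] at hE
    have h5 := hpos (z :: T) (List.suffix_refl _) z
    rw [prd_cons, LinearEquiv.mul_apply, sigmaE_apply, sigmaL_apply] at h5
    have h8 := cf_sink Λ z hT.1 (prd A hA T v)
    rw [hΛ] at h8
    rw [h8] at h5
    have h6 : ∑ b, (flipO z Λ z b : ℤ) * prd A hA T v b = inS Λ z (prd A hA T v) := by
      unfold inS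
      exact Finset.sum_congr rfl fun b _ => by simp [flipO]
    rw [h6] at hE
    have h7 := h1 z
    simp at h5 h7
    nlinarith

lemma not_mem_of_arrow {n : ℕ} (x y : Fin n) (L : List (Fin n)) (hL : y ∉ L) :
    ∀ (Λ : Fin n → Fin n → ℕ), Λ x y ≠ 0 → Admissible Λ L → x ∉ L := by
  induction L with
  | nil => simp
  | cons z L ih =>
    intro Λ h hadm
    simp only [List.mem_cons, not_or] at hL
    have hzx : x ≠ z := by
      rintro rfl
      exact h (hadm.1 y)
    simp only [List.mem_cons, not_or]
    refine ⟨hzx, ih hL.2 (flipO z Λ) ?_ hadm.2⟩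
    simpa [flipO, hzx, hL.1] using h

lemma not_mem_of_noadj {n : ℕ} (Λ : Fin n → Fin n → ℕ) (x : Fin n) (hx : IsSink Λ x)
    (hnb : ∃ y, edges Λ x y ≠ 0) (L : List (Fin n)) (hL : Admissible (flipO x Λ) L)
    (hno : ∀ y ∈ L, edges Λ x y = 0) : x ∉ L := by
  obtain ⟨y, hy⟩ := hnb
  have hxy : x ≠ y := by
    rintro rfl
    exact hy (by simp [edges, hx x])
  refine not_mem_of_arrow x y L (fun h => hy (hno y h)) (flipO x Λ) ?_ hL
  simp [flipO]
  simpa [edges, hx y] using hy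

lemma adm_congr {n : ℕ} (Q : List (Fin n)) : ∀ (Λ₁ Λ₂ : Fin n → Fin n → ℕ),
    (∀ a ∈ Q, ∀ b, Λ₁ a b = Λ₂ a b ∧ Λ₁ b a = Λ₂ b a) → Admissible Λ₁ Q → Admissible Λ₂ Q := by
  induction Q with
  | nil => intros; trivial
  | cons z Q ih =>
    intro Λ₁ Λ₂ h hadm
    refine ⟨fun y => by rw [← (h z (by simp) y).1]; exact hadm.1 y, ih _ _ ?_ hadm.2⟩
    intro a ha b
    have := h a (by simp [ha]) b
    simp only [flipO]
    split_ifs <;> simp [this]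

lemma prd_coord {n : ℕ} (A : Fin n → Fin n → ℤ) (hA : ∀ i, A i i = 2) (Q : List (Fin n))
    (b : Fin n) (hb : b ∉ Q) (v : Fin n → ℤ) : prd A hA Q v b = v b := by
  induction Q with
  | nil => rfl
  | cons z Q ih =>
    simp only [List.mem_cons, not_or] at hb
    rw [prd_cons, LinearEquiv.mul_apply, sigmaE_apply, sigmaL_coord_ne _ _ _ hb.1, ih hb.2]

/-- coefficient of `cf` when all letters are away from `x` -/
lemma cf_away {n : ℕ} (Λ : Fin n → Fin n → ℕ) (hA : ∀ i, cartanOf Λ i i = 2) (x y : Fin n)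
    (Q : List (Fin n)) (hxQ : x ∉ Q) (hno : ∀ z ∈ Q, edges Λ x z = 0) :
    cf (cartanOf Λ) x (prd (cartanOf Λ) hA Q (Pi.single y 1)) = cartanOf Λ x y := by
  rw [← cf_single (cartanOf Λ) x y]
  unfold cf
  refine Finset.sum_congr rfl fun l _ => ?_
  by_cases hl : l ∈ Q
  · have : x ≠ l := by rintro rfl; exact hxQ hl
    simp [cartanOf, this, hno l hl]
  · rw [prd_coord _ _ _ _ hl]

lemma first_split {α : Type} (p : α → Prop) (Q : List α) (h : ∃ y ∈ Q, p y) :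
    ∃ Q1 y Q2, Q = Q1 ++ y :: Q2 ∧ p y ∧ ∀ z ∈ Q1, ¬ p z := by
  classical
  induction Q with
  | nil => simp at h
  | cons a Q ih =>
    by_cases ha : p a
    · exact ⟨[], a, Q, rfl, ha, by simp⟩
    · obtain ⟨y, hy, hp⟩ := h
      have : y ∈ Q := by
        rcases List.mem_cons.1 hy with rfl | h
        · exact absurd hp ha
        · exact h
      obtain ⟨Q1, y, Q2, e, hy, hz⟩ := ih ⟨y, this, hp⟩
      refine ⟨a :: Q1, y, Q2, by rw [e]; rfl, hy, ?_⟩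
      intro z hz'
      rcases List.mem_cons.1 hz' with rfl | h
      · exact ha
      · exact hz z h

theorem all_pos {n : ℕ} (Λ : Fin n → Fin n → ℕ) (hloop : ∀ a, Λ a a = 0)
    (hnb : ∀ x, ∃ y, edges Λ x y ≠ 0) (S : List (Fin n)) (hS : Admissible Λ S)
    (H1 : ∀ P x, S = P ++ [x] → ∀ T, T <:+ P →
      0 ≤ prd (cartanOf Λ) (cartan_diag Λ) T (Pi.single x 1))
    (H2 : ∀ P x Q, S = P ++ x :: Q → Q ≠ [] → ∃ y ∈ Q, edges Λ x y ≠ 0) (m : ℕ) :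
    ∀ P x Q, Q.length = m → S = P ++ x :: Q → ∀ T, T <:+ P →
      0 ≤ prd (cartanOf Λ) (cartan_diag Λ) T (Pi.single x 1) := by
  induction m using Nat.strong_induction_on with
  | _ m IH =>
  intro P x Q hm e T hT
  by_cases hQ : Q = []
  · subst hQ
    exact H1 P x e T hT
  obtain ⟨Q1, y, Q2, rfl, hxy, hno⟩ := first_split _ Q (H2 P x Q e hQ)
  simp only [ne_eq, not_not] at hno
  have hIH := IH Q2.length (by rw [← hm]; simp; omega) (P ++ x :: Q1) y Q2 rfl (by rw [e]; simp)
  obtain ⟨P', rfl⟩ := hT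
  rw [e, adm_append, Admissible, adm_append, adm_append, orient_append] at hS
  obtain ⟨⟨hP', hT⟩, hsink, hQ1, -⟩ := hS
  have hxQ1 : x ∉ Q1 := by
    apply not_mem_of_noadj _ x hsink _ Q1 hQ1
    · intro z hz
      rw [edges_orient, edges_orient]
      exact hno z hz
    · rw [edges_orient, edges_orient]
      exact hnb x
  have hxney : x ≠ y := by
    rintro rfl
    exact hxy (by simp [edges, hloop])
  refine pos_of_pair (cartanOf Λ) (cartan_diag Λ) (cartan_sym Λ) (cartan_neg Λ) x
    (prd (cartanOf Λ) (cartan_diag Λ) (x :: Q1) (Pi.single y 1)) ?_ T (orientAfter Λ P')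
    (cartan_orient _ _) hT hsink ?_
  · rw [prd_cons, LinearEquiv.mul_apply, sigmaE_apply, sigmaL_apply,
      cf_away Λ _ x y Q1 hxQ1 hno]
    simp [prd_coord _ _ _ _ hxQ1, cartanOf, hxney]
    omega
  · intro T0 h0
    rw [← LinearEquiv.mul_apply, ← prd_append]
    apply hIH
    obtain ⟨R, rfl⟩ := h0
    exact ⟨P' ++ R, by simp⟩

/-- numerical annihilation -/
def Hit {n : ℕ} (Λ : Fin n → Fin n → ℕ) (d : Fin n → ℤ) (S : List (Fin n)) : Prop :=
  Admissible Λ S ∧ ∃ T z, S = T ++ [z] ∧ d = prd (cartanOf Λ) (cartan_diag Λ) T (Pi.single z 1)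

lemma min_adj {n : ℕ} (Λ : Fin n → Fin n → ℕ) 
    (hnb : ∀ x, ∃ y, edges Λ x y ≠ 0) (d : Fin n → ℤ) (S : List (Fin n)) (hS : Hit Λ d S)
    (hmin : ∀ S', Hit Λ d S' → S.length ≤ S'.length) :
    ∀ P x Q, S = P ++ x :: Q → Q ≠ [] → ∃ y ∈ Q, edges Λ x y ≠ 0 := by
  intro P x Q e hQ
  by_contra hno
  push Not at hno
  obtain ⟨hadm, T, z, e2, hd⟩ := hS
  have hadm0 := hadm
  rw [e, adm_append, Admissible] at hadm
  obtain ⟨hP, hsink, hQa⟩ := hadm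
  have hxQ : x ∉ Q := by
    apply not_mem_of_noadj _ x hsink _ Q hQa
    · intro z hz
      rw [edges_orient]
      exact hno z hz
    · rw [edges_orient]
      exact hnb x
  rcases List.eq_nil_or_concat Q with rfl | ⟨Q', z', rfl⟩
  · exact hQ rfl
  rw [List.concat_eq_append] at *
  have e3 : T = P ++ x :: Q' ∧ z = z' := by
    have : T ++ [z] = (P ++ x :: Q') ++ [z'] := by rw [← e2, e]; simp
    have := List.append_inj' this rfl
    simpa using this
  obtain ⟨rfl, rfl⟩ := e3
  simp only [List.mem_append, List.mem_singleton, not_or] at hxQ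
  have hxz := hno z (by simp)
  have key : Hit Λ d (P ++ (Q' ++ [z])) := by
    refine ⟨?_, P ++ Q', z, by simp, ?_⟩
    · rw [adm_append]
      refine ⟨hP, adm_congr _ (flipO x (orientAfter Λ P)) _ ?_ hQa⟩
      intro a ha b
      have hax : a ≠ x := by
        rintro rfl
        simp at ha
        tauto
      have h0 := hno a ha
      rw [← edges_orient P] at h0
      simp only [edges, Nat.add_eq_zero_iff] at h0
      by_cases hb : b = x
      · subst hb; simp [flipO, h0]
      · simp [flipO, hax, hb]
    · rw [hd, prd_append, prd_append, LinearEquiv.mul_apply, LinearEquiv.mul_apply]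
      congr 1
      rw [prd_cons, LinearEquiv.mul_apply, sigmaE_apply, sigmaL_apply,
        cf_away Λ _ x z Q' hxQ.1 (fun w hw => hno w (by simp [hw]))]
      simp [cartanOf, hxz, hxQ.2]
  have := hmin _ key
  rw [e] at this
  simp at this

end Comb

/-! ## Part 3: reflection functors -/

section Reps

/-- invariant family of subspaces -/
def Inv {k : Type} [Field k] {n : ℕ} {Λ : Fin n → Fin n → ℕ} (M : Rep k n Λ)
    (U : ∀ x, Submodule k (Fin (M.d x) → k)) : Prop :=
  ∀ a b i, ∀ v ∈ U a, M.f a b i v ∈ U b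

/-- internal form of indecomposability -/
def IndS {k : Type} [Field k] {n : ℕ} {Λ : Fin n → Fin n → ℕ} (M : Rep k n Λ) : Prop :=
  ¬ IsZeroRep M ∧ ∀ U W : (∀ x, Submodule k (Fin (M.d x) → k)), (∀ x, IsCompl (U x) (W x)) →
    Inv M U → Inv M W → (∀ x, U x = ⊥) ∨ (∀ x, W x = ⊥)

/-- a subrepresentation -/
noncomputable def subRep {k : Type} [Field k] {n : ℕ} {Λ : Fin n → Fin n → ℕ} (M : Rep k n Λ)
    (U : ∀ x, Submodule k (Fin (M.d x) → k)) (hU : Inv M U) : Rep k n Λ where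
  d x := Module.finrank k (U x)
  f a b i := (Module.finBasis k (U b)).equivFun.toLinearMap ∘ₗ
    ((M.f a b i).restrict (hU a b i)) ∘ₗ (Module.finBasis k (U a)).equivFun.symm.toLinearMap

lemma subRep_f {k : Type} [Field k] {n : ℕ} {Λ : Fin n → Fin n → ℕ} (M : Rep k n Λ)
    (U : ∀ x, Submodule k (Fin (M.d x) → k)) (hU : Inv M U) (a b : Fin n) (i : Fin (Λ a b))
    (u : U a) : (subRep M U hU).f a b i ((Module.finBasis k (U a)).equivFun u) =
      (Module.finBasis k (U b)).equivFun ((M.f a b i).restrict (hU a b i) u) := by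
  have h := (Module.finBasis k (U a)).equivFun.symm_apply_apply u
  exact congrArg (fun t => (Module.finBasis k (U b)).equivFun ((M.f a b i).restrict (hU a b i) t)) h

lemma dSum_f {k : Type} [Field k] {n : ℕ} {Λ : Fin n → Fin n → ℕ} (A B : Rep k n Λ)
    (a b : Fin n) (i : Fin (Λ a b)) (p : Fin (A.d a) → k) (q : Fin (B.d a) → k) :
    (dSum A B).f a b i ((splitL k (A.d a) (B.d a)).symm (p, q)) =
      (splitL k (A.d b) (B.d b)).symm (A.f a b i p, B.f a b i q) := by
  have h := (splitL k (A.d a) (B.d a)).apply_symm_apply (p, q)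
  exact congrArg (fun t => (splitL k (A.d b) (B.d b)).symm
    (LinearMap.prodMap (A.f a b i) (B.f a b i) t)) h

lemma indS_of_indecomp {k : Type} [Field k] {n : ℕ} {Λ : Fin n → Fin n → ℕ} (M : Rep k n Λ)
    (h : Indecomp M) : IndS M := by
  refine ⟨h.1, fun U W hc hU hW => ?_⟩
  have key : RepIso M (dSum (subRep M U hU) (subRep M W hW)) := by
    refine ⟨fun x => (Submodule.prodEquivOfIsCompl _ _ (hc x)).symm.trans
      (((Module.finBasis k (U x)).equivFun.prodCongr (Module.finBasis k (W x)).equivFun).trans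
        (splitL k _ _).symm), ?_⟩
    intro a b i v
    obtain ⟨⟨u, w⟩, rfl⟩ := (Submodule.prodEquivOfIsCompl _ _ (hc a)).surjective v
    have h1 : M.f a b i (Submodule.prodEquivOfIsCompl _ _ (hc a) (u, w)) =
        Submodule.prodEquivOfIsCompl _ _ (hc b)
          ((M.f a b i).restrict (hU a b i) u, (M.f a b i).restrict (hW a b i) w) := by
      simp
    rw [h1]
    simp only [LinearEquiv.trans_apply, LinearEquiv.symm_apply_apply]
    symm
    refine (dSum_f _ _ a b i _ _).trans ?_
    refine congrArg (splitL k _ _).symm (Prod.ext ?_ ?_)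
    · exact subRep_f M U hU a b i u
    · exact subRep_f M W hW a b i w
  rcases h.2 _ _ key with h0 | h0
  · exact Or.inl fun x => Submodule.finrank_eq_zero.1 (h0 x)
  · exact Or.inr fun x => Submodule.finrank_eq_zero.1 (h0 x)

lemma dim_zero_of {k : Type} [Field k] {m : ℕ} (h : ∀ v : Fin m → k, v = 0) : m = 0 := by
  by_contra hm
  have := congrFun (h (fun _ => 1)) ⟨0, Nat.pos_of_ne_zero hm⟩
  simp at this

lemma inMap_single {k : Type} [Field k] {n : ℕ} (Λ : Fin n → Fin n → ℕ) (M : Rep k n Λ) (x : Fin n)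
    (p : Arin Λ x) (v : Fin (M.d p.1) → k) :
    inMap Λ M x (Pi.single p v) = M.f p.1 x p.2 v := by
  unfold inMap
  rw [LinearMap.sum_apply, Finset.sum_eq_single p]
  · simp
  · intro q _ hq
    simp [Pi.single_eq_of_ne hq]
  · simp

/-- `N` looks like `F_x⁺ M` -/
structure PlusData {k : Type} [Field k] {n : ℕ} (x : Fin n) (Λ : Fin n → Fin n → ℕ)
    (M : Rep k n Λ) (N : Rep k n (flipO x Λ)) where
  e : ∀ z, z ≠ x → ((Fin (N.d z) → k) ≃ₗ[k] (Fin (M.d z) → k))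
  ex : (Fin (N.d x) → k) ≃ₗ[k] LinearMap.ker (inMap Λ M x)
  h1 : ∀ a b (ha : a ≠ x) (hb : b ≠ x) (i : Fin (flipO x Λ a b)) (j : Fin (Λ a b)),
    (i : ℕ) = j → ∀ v, e b hb (N.f a b i v) = M.f a b j (e a ha v)
  h2 : ∀ b (hb : b ≠ x) (i : Fin (flipO x Λ x b)) (j : Fin (Λ b x)),
    (i : ℕ) = j → ∀ v, e b hb (N.f x b i v) = (ex v).1 ⟨b, j⟩

lemma castL_castL {k : Type} [Field k] {m m' : ℕ} (h : m = m') (h' : m' = m) (v : Fin m → k) :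
    castL k h' (castL k h v) = v := by
  subst h
  rfl

lemma castL_castL' {k : Type} [Field k] {m m' : ℕ} (h : m = m') (h' : m = m') (v : Fin m → k) :
    (castL k h).symm (castL k h' v) = v := by
  subst h
  rfl

lemma plus_d_ne {k : Type} [Field k] {n : ℕ} {x : Fin n} {Λ : Fin n → Fin n → ℕ}
    (M : Rep k n Λ) {z : Fin n} (hz : z ≠ x) : (reflPlus x Λ M).d z = M.d z := if_neg hz

lemma plus_d_x {k : Type} [Field k] {n : ℕ} {x : Fin n} {Λ : Fin n → Fin n → ℕ}
    (M : Rep k n Λ) : (reflPlus x Λ M).d x = Module.finrank k (LinearMap.ker (inMap Λ M x)) :=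
  if_pos rfl

lemma plus_f_ne {k : Type} [Field k] {n : ℕ} {x : Fin n} {Λ : Fin n → Fin n → ℕ}
    (M : Rep k n Λ) {a b : Fin n} (ha : a ≠ x) (hb : b ≠ x) (i : Fin (flipO x Λ a b))
    (h : flipO x Λ a b = Λ a b) :
    (reflPlus x Λ M).f a b i = (castL k (plus_d_ne M hb).symm).toLinearMap ∘ₗ
      M.f a b (Fin.cast h i) ∘ₗ (castL k (plus_d_ne M ha)).toLinearMap :=
  (dif_neg ha).trans (dif_neg hb)

lemma plus_f_x {k : Type} [Field k] {n : ℕ} {x : Fin n} {Λ : Fin n → Fin n → ℕ}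
    (M : Rep k n Λ) {b : Fin n} (hb : b ≠ x) (i : Fin (flipO x Λ x b))
    (h : flipO x Λ x b = Λ b x) :
    (reflPlus x Λ M).f x b i = (castL k (plus_d_ne M hb).symm).toLinearMap ∘ₗ
      (LinearMap.proj (φ := fun p : Arin Λ x => Fin (M.d p.1) → k)
            (⟨b, Fin.cast h i⟩ : Arin Λ x)) ∘ₗ
          (LinearMap.ker (inMap Λ M x)).subtype ∘ₗ
          (kerEquiv Λ M x).symm.toLinearMap ∘ₗ (castL k (plus_d_x M)).toLinearMap :=
  (dif_pos rfl).trans (dif_neg hb)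

lemma minus_d_ne {k : Type} [Field k] {n : ℕ} {x : Fin n} {Λ : Fin n → Fin n → ℕ}
    (N : Rep k n (flipO x Λ)) {z : Fin n} (hz : z ≠ x) : (reflMinus x Λ N).d z = N.d z := if_neg hz

lemma minus_d_x {k : Type} [Field k] {n : ℕ} {x : Fin n} {Λ : Fin n → Fin n → ℕ}
    (N : Rep k n (flipO x Λ)) : (reflMinus x Λ N).d x =
      Module.finrank k (((p : Aout (flipO x Λ) x) → (Fin (N.d p.1) → k)) ⧸
        LinearMap.range (outMap (flipO x Λ) N x)) :=
  if_pos rfl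

lemma minus_f_ne {k : Type} [Field k] {n : ℕ} {x : Fin n} {Λ : Fin n → Fin n → ℕ}
    (N : Rep k n (flipO x Λ)) {a b : Fin n} (ha : a ≠ x) (hb : b ≠ x) (i : Fin (Λ a b))
    (h : Λ a b = flipO x Λ a b) :
    (reflMinus x Λ N).f a b i = (castL k (minus_d_ne N hb).symm).toLinearMap ∘ₗ
      N.f a b (Fin.cast h i) ∘ₗ (castL k (minus_d_ne N ha)).toLinearMap :=
  (dif_neg hb).trans (dif_neg ha)

lemma minus_f_x {k : Type} [Field k] {n : ℕ} {x : Fin n} {Λ : Fin n → Fin n → ℕ}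
    (N : Rep k n (flipO x Λ)) {a : Fin n} (ha : a ≠ x) (i : Fin (Λ a x))
    (h : Λ a x = flipO x Λ x a) :
    (reflMinus x Λ N).f a x i = (castL k (minus_d_x N).symm).toLinearMap ∘ₗ
          (cokerEquiv (flipO x Λ) N x).toLinearMap ∘ₗ
          (LinearMap.range (outMap (flipO x Λ) N x)).mkQ ∘ₗ
          (LinearMap.single k (fun p : Aout (flipO x Λ) x => Fin (N.d p.1) → k)
            (⟨a, Fin.cast h i⟩ : Aout (flipO x Λ) x)) ∘ₗ
          (castL k (minus_d_ne N ha)).toLinearMap :=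
  (dif_pos rfl).trans (dif_neg ha)

/-- the reflection satisfies the data -/
noncomputable def plusData {k : Type} [Field k] {n : ℕ} (x : Fin n) (Λ : Fin n → Fin n → ℕ)
    (M : Rep k n Λ) : PlusData x Λ M (reflPlus x Λ M) where
  e z hz := castL k (plus_d_ne M hz)
  ex := (castL k (plus_d_x M)).trans (kerEquiv Λ M x).symm
  h1 := by
    intro a b ha hb i j hij v
    have h : flipO x Λ a b = Λ a b := by simp [flipO, ha, hb]
    have : j = Fin.cast h i := Fin.ext hij.symm
    subst this
    rw [plus_f_ne M ha hb i h]
    simp only [LinearMap.comp_apply, LinearEquiv.coe_coe, castL_castL]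
  h2 := by
    intro b hb i j hij v
    have h : flipO x Λ x b = Λ b x := by simp [flipO]
    have : j = Fin.cast h i := Fin.ext hij.symm
    subst this
    rw [plus_f_x M hb i h]
    simp only [LinearMap.comp_apply, LinearEquiv.coe_coe, castL_castL]
    rfl

/-- transport along isomorphism -/
noncomputable def PlusData.trans {k : Type} [Field k] {n : ℕ} {x : Fin n} {Λ : Fin n → Fin n → ℕ}
    {M : Rep k n Λ} {N N' : Rep k n (flipO x Λ)} (D : PlusData x Λ M N)
    (g : ∀ x, (Fin (N.d x) → k) ≃ₗ[k] (Fin (N'.d x) → k))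
    (hg : ∀ a b i v, g b (N.f a b i v) = N'.f a b i (g a v)) : PlusData x Λ M N' where
  e z hz := (g z).symm.trans (D.e z hz)
  ex := (g x).symm.trans D.ex
  h1 := by
    intro a b ha hb i j hij v
    obtain ⟨v, rfl⟩ := (g a).surjective v
    rw [← hg]
    simp [D.h1 a b ha hb i j hij]
  h2 := by
    intro b hb i j hij v
    obtain ⟨v, rfl⟩ := (g x).surjective v
    rw [← hg]
    simp [D.h2 b hb i j hij]

lemma arin_ne {n : ℕ} {x : Fin n} {Λ : Fin n → Fin n → ℕ} (hx : IsSink Λ x) (p : Arin Λ x) :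
    p.1 ≠ x := by
  rcases p with ⟨b, j⟩
  rintro h
  change b = x at h
  subst h
  rw [hx b] at j
  exact j.elim0

/-- transported subspaces away from `x` -/
def Yf {k : Type} [Field k] {n : ℕ} {x : Fin n} {Λ : Fin n → Fin n → ℕ}
    {M : Rep k n Λ} {N : Rep k n (flipO x Λ)} (D : PlusData x Λ M N)
    (U : ∀ x, Submodule k (Fin (N.d x) → k)) (z : Fin n) : Submodule k (Fin (M.d z) → k) :=
  ⨆ (h : z ≠ x), (U z).map (D.e z h).toLinearMap

lemma Yf_eq {k : Type} [Field k] {n : ℕ} {x : Fin n} {Λ : Fin n → Fin n → ℕ}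
    {M : Rep k n Λ} {N : Rep k n (flipO x Λ)} (D : PlusData x Λ M N)
    (U : ∀ x, Submodule k (Fin (N.d x) → k)) (z : Fin n) (h : z ≠ x) :
    Yf D U z = (U z).map (D.e z h).toLinearMap := iSup_pos h

/-- the transported family -/
noncomputable def Uf {k : Type} [Field k] {n : ℕ} {x : Fin n} {Λ : Fin n → Fin n → ℕ}
    {M : Rep k n Λ} {N : Rep k n (flipO x Λ)} (D : PlusData x Λ M N)
    (U : ∀ x, Submodule k (Fin (N.d x) → k)) : ∀ z, Submodule k (Fin (M.d z) → k) :=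
  Function.update (Yf D U) x
    ((Submodule.pi Set.univ (fun p : Arin Λ x => Yf D U p.1)).map (inMap Λ M x))

lemma Uf_x {k : Type} [Field k] {n : ℕ} {x : Fin n} {Λ : Fin n → Fin n → ℕ}
    {M : Rep k n Λ} {N : Rep k n (flipO x Λ)} (D : PlusData x Λ M N)
    (U : ∀ x, Submodule k (Fin (N.d x) → k)) : Uf D U x = 
    ((Submodule.pi Set.univ (fun p : Arin Λ x => Yf D U p.1)).map (inMap Λ M x)) := by
  simp [Uf]

lemma Uf_ne {k : Type} [Field k] {n : ℕ} {x : Fin n} {Λ : Fin n → Fin n → ℕ}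
    {M : Rep k n Λ} {N : Rep k n (flipO x Λ)} (D : PlusData x Λ M N)
    (U : ∀ x, Submodule k (Fin (N.d x) → k)) (z : Fin n) (h : z ≠ x) : Uf D U z = Yf D U z := by
  simp [Uf, h]

lemma Uf_inv {k : Type} [Field k] {n : ℕ} {x : Fin n} {Λ : Fin n → Fin n → ℕ} (hx : IsSink Λ x)
    {M : Rep k n Λ} {N : Rep k n (flipO x Λ)} (D : PlusData x Λ M N)
    (U : ∀ x, Submodule k (Fin (N.d x) → k)) (hU : Inv N U) : Inv M (Uf D U) := by
  intro a b i v hv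
  have ha : a ≠ x := by
    rintro rfl
    rw [hx b] at i
    exact i.elim0
  rw [Uf_ne D U a ha] at hv
  by_cases hb : b = x
  · subst hb
    rw [Uf_x]
    refine ⟨Pi.single (⟨a, i⟩ : Arin Λ b) v, ?_, inMap_single Λ M b ⟨a, i⟩ v⟩
    intro p _
    by_cases hp : p = ⟨a, i⟩
    · subst hp; simpa using hv
    · simp only [Pi.single_eq_of_ne hp]; exact Submodule.zero_mem _
  · rw [Uf_ne D U b hb, Yf_eq D U b hb]
    rw [Yf_eq D U a ha] at hv
    obtain ⟨u, hu, rfl⟩ := hv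
    refine ⟨N.f a b (Fin.cast (by simp [flipO, ha, hb]) i) u, hU _ _ _ u hu, ?_⟩
    exact D.h1 a b ha hb _ i rfl u

lemma Yf_compl {k : Type} [Field k] {n : ℕ} {x : Fin n} {Λ : Fin n → Fin n → ℕ}
    {M : Rep k n Λ} {N : Rep k n (flipO x Λ)} (D : PlusData x Λ M N)
    (U W : ∀ x, Submodule k (Fin (N.d x) → k)) (hc : ∀ x, IsCompl (U x) (W x)) (z : Fin n)
    (h : z ≠ x) : IsCompl (Yf D U z) (Yf D W z) := by
  rw [Yf_eq D U z h, Yf_eq D W z h]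
  exact (Submodule.orderIsoMapComap (D.e z h)).isCompl (hc z)

lemma ex_mem {k : Type} [Field k] {n : ℕ} {x : Fin n} {Λ : Fin n → Fin n → ℕ} (hx : IsSink Λ x)
    {M : Rep k n Λ} {N : Rep k n (flipO x Λ)} (D : PlusData x Λ M N)
    (U : ∀ x, Submodule k (Fin (N.d x) → k)) (hU : Inv N U) (u : Fin (N.d x) → k) (hu : u ∈ U x)
    (p : Arin Λ x) : (D.ex u).1 p ∈ Yf D U p.1 := by
  rcases p with ⟨b, j⟩
  have hb : b ≠ x := arin_ne hx ⟨b, j⟩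
  rw [← D.h2 b hb (Fin.cast (by simp [flipO]) j) j rfl u, Yf_eq D U b hb]
  exact ⟨_, hU _ _ _ u hu, rfl⟩

lemma Uf_compl {k : Type} [Field k] {n : ℕ} {x : Fin n} {Λ : Fin n → Fin n → ℕ} (hx : IsSink Λ x)
    {M : Rep k n Λ} {N : Rep k n (flipO x Λ)} (D : PlusData x Λ M N)
    (hs : Function.Surjective (inMap Λ M x))
    (U W : ∀ x, Submodule k (Fin (N.d x) → k)) (hc : ∀ x, IsCompl (U x) (W x)) 
    (hU : Inv N U) (hW : Inv N W) (z : Fin n) : IsCompl (Uf D U z) (Uf D W z) := by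
  by_cases hz : z = x
  swap
  · rw [Uf_ne D U z hz, Uf_ne D W z hz]
    exact Yf_compl D U W hc z hz
  subst hz
  rw [Uf_x, Uf_x]
  constructor
  · rw [Submodule.disjoint_def]
    rintro v ⟨p, hp, rfl⟩ ⟨q, hq, hpq⟩
    have hker : p - q ∈ LinearMap.ker (inMap Λ M z) := by
      rw [LinearMap.mem_ker, map_sub, hpq, sub_self]
    obtain ⟨nn, hn⟩ := D.ex.surjective ⟨p - q, hker⟩
    obtain ⟨nU, hnU, nW, hnW, rfl⟩ := Submodule.mem_sup.1
      (show nn ∈ U z ⊔ W z by rw [(hc z).sup_eq_top]; trivial)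
    have hpe : p = (D.ex nU).1 := by
      funext r
      have h1 := ex_mem hx D U hU nU hnU r
      have h2 := ex_mem hx D W hW nW hnW r
      have h3 : p r - q r = (D.ex nU).1 r + (D.ex nW).1 r := by
        have := congrArg (fun t => t.1 r) hn
        simp only [map_add] at this
        exact this.symm
      have hd := (Yf_compl D U W hc r.1 (arin_ne hx r)).disjoint
      rw [Submodule.disjoint_def] at hd
      have h4 : p r - (D.ex nU).1 r = q r + (D.ex nW).1 r := by
        rw [sub_eq_iff_eq_add] at h3 ⊢
        rw [h3]
        abel
      have := hd _ (Submodule.sub_mem _ (hp r trivial) h1)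
        (by rw [h4]; exact Submodule.add_mem _ (hq r trivial) h2)
      exact sub_eq_zero.1 this
    rw [hpe]
    exact (D.ex nU).2
  · rw [codisjoint_iff, eq_top_iff]
    intro v _
    obtain ⟨p, rfl⟩ := hs v
    have : ∀ r : Arin Λ z, ∃ a ∈ Yf D U r.1, ∃ b ∈ Yf D W r.1, a + b = p r := by
      intro r
      apply Submodule.mem_sup.1
      rw [(Yf_compl D U W hc r.1 (arin_ne hx r)).sup_eq_top]
      trivial
    choose a ha b hb hab using this
    have e : p = a + b := by
      funext r
      exact (hab r).symm
    rw [e, map_add]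
    exact Submodule.add_mem_sup ⟨a, fun r _ => ha r, rfl⟩ ⟨b, fun r _ => hb r, rfl⟩

lemma bot_of_Uf {k : Type} [Field k] {n : ℕ} {x : Fin n} {Λ : Fin n → Fin n → ℕ} (hx : IsSink Λ x)
    {M : Rep k n Λ} {N : Rep k n (flipO x Λ)} (D : PlusData x Λ M N)
    (U : ∀ x, Submodule k (Fin (N.d x) → k)) (hU : Inv N U) (h : ∀ z, Uf D U z = ⊥) :
    ∀ z, U z = ⊥ := by
  intro z
  by_cases hz : z = x
  · subst hz
    rw [eq_bot_iff]
    intro u hu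
    have : D.ex u = 0 := by
      apply Subtype.ext
      funext r
      have h1 := ex_mem hx D U hU u hu r
      rw [← Uf_ne D U _ (arin_ne hx r), h] at h1
      exact h1
    simpa using this
  · have := h z
    rw [Uf_ne D U z hz, Yf_eq D U z hz] at this
    exact (Submodule.map_eq_bot_iff (p := U z) (e := D.e z hz)).1 this

lemma indS_plus {k : Type} [Field k] {n : ℕ} {x : Fin n} {Λ : Fin n → Fin n → ℕ} (hx : IsSink Λ x)
    {M : Rep k n Λ} {N : Rep k n (flipO x Λ)} (D : PlusData x Λ M N)
    (hs : Function.Surjective (inMap Λ M x)) (hM : IndS M) : IndS N := by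
  constructor
  · intro h0
    apply hM.1
    have h1 : ∀ z, z ≠ x → M.d z = 0 := by
      intro z hz
      have := (D.e z hz).finrank_eq
      simp only [Module.finrank_fintype_fun_eq_card, Fintype.card_fin] at this
      rw [← this, h0 z]
    intro z
    by_cases hz : z = x
    · subst hz
      apply dim_zero_of (k := k)
      intro v
      obtain ⟨p, rfl⟩ := hs v
      have : p = 0 := by
        funext r j
        rw [h1 _ (arin_ne hx r)] at j
        exact j.elim0
      rw [this, map_zero]
    · exact h1 z hz
  · intro U W hc hU hW
    rcases hM.2 (Uf D U) (Uf D W) (Uf_compl hx D hs U W hc hU hW) (Uf_inv hx D U hU)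
      (Uf_inv hx D W hW) with h | h
    · exact Or.inl (bot_of_Uf hx D U hU h)
    · exact Or.inr (bot_of_Uf hx D W hW h)

/-- dimension vector -/
def dv {k : Type} [Field k] {n : ℕ} {Λ : Fin n → Fin n → ℕ} (M : Rep k n Λ) : Fin n → ℤ :=
  fun z => (M.d z : ℤ)

lemma dv_plus {k : Type} [Field k] {n : ℕ} {x : Fin n} {Λ : Fin n → Fin n → ℕ} (hx : IsSink Λ x)
    {M : Rep k n Λ} {N : Rep k n (flipO x Λ)} (D : PlusData x Λ M N)
    (hs : Function.Surjective (inMap Λ M x)) :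
    dv N = sigmaL (cartanOf Λ) x (dv M) := by
  funext z
  by_cases hz : z = x
  · subst hz
    rw [sigmaL_apply, cf_sink Λ z hx]
    have h1 := D.ex.finrank_eq
    have h2 := LinearMap.finrank_range_add_finrank_ker (inMap Λ M z)
    rw [LinearMap.range_eq_top.2 hs, finrank_top, ← h1] at h2
    have h3 : Module.finrank k ((p : Arin Λ z) → (Fin (M.d p.1) → k)) = ∑ y, Λ y z * M.d y := by
      rw [Module.finrank_pi_fintype, Fintype.sum_sigma]
      simp
    rw [h3] at h2
    simp only [Module.finrank_fintype_fun_eq_card, Fintype.card_fin] at h2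
    have h4 : inS Λ z (dv M) = (M.d z : ℤ) + N.d z := by
      unfold inS dv
      exact_mod_cast h2.symm
    rw [h4]
    simp [dv]
    ring
  · rw [sigmaL_coord_ne _ _ _ hz]
    have := (D.e z hz).finrank_eq
    simp only [Module.finrank_fintype_fun_eq_card, Fintype.card_fin] at this
    simp [dv, this]

lemma sink_cases {k : Type} [Field k] {n : ℕ} {x : Fin n} {Λ : Fin n → Fin n → ℕ}
    (hx : IsSink Λ x) (M : Rep k n Λ) (hM : IndS M) :
    dv M = Pi.single x 1 ∨ Function.Surjective (inMap Λ M x) := by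
  have noarr : ∀ b, Fin (Λ x b) → False := by
    intro b i
    rw [hx b] at i
    exact i.elim0
  obtain ⟨C, hC⟩ := Submodule.exists_isCompl (LinearMap.range (inMap Λ M x))
  have := hM.2 (Function.update (fun _ => ⊤) x (LinearMap.range (inMap Λ M x)))
    (Function.update (fun _ => ⊥) x C) ?_ ?_ ?_
  · rcases this with h | h
    · left
      have h1 : ∀ z, z ≠ x → M.d z = 0 := by
        intro z hz
        have h2 := h z
        rw [Function.update_of_ne hz] at h2
        apply dim_zero_of (k := k)
        intro v
        have : v ∈ (⊤ : Submodule k (Fin (M.d z) → k)) := trivial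
        rw [h2] at this
        exact this
      have h2 : M.d x ≠ 0 := by
        intro h0
        apply hM.1
        intro z
        by_cases hz : z = x
        · rw [hz, h0]
        · exact h1 z hz
      have fz : ∀ a b i v, M.f a b i v = 0 := by
        intro a b i v
        have ha : a ≠ x := by
          rintro rfl
          exact noarr b i
        have : v = 0 := by
          funext j
          rw [h1 a ha] at j
          exact j.elim0
        rw [this, map_zero]
      let w : Fin (M.d x) → k := fun _ => 1
      have hw : w ≠ 0 := by
        intro h0
        have := congrFun h0 ⟨0, Nat.pos_of_ne_zero h2⟩
        simp [w] at this
      obtain ⟨C', hC'⟩ := Submodule.exists_isCompl (Submodule.span k {w})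
      have := hM.2 (Function.update (fun _ => ⊤) x (Submodule.span k {w}))
        (Function.update (fun _ => ⊥) x C') ?_ ?_ ?_
      · rcases this with h' | h'
        · exfalso
          have := h' x
          rw [Function.update_self] at this
          exact hw (Submodule.span_singleton_eq_bot.1 this)
        · have := h' x
          rw [Function.update_self] at this
          subst this
          have ht : Submodule.span k {w} = ⊤ := by simpa using hC'.sup_eq_top
          have hf := finrank_span_singleton (K := k) hw
          rw [ht, finrank_top, Module.finrank_fintype_fun_eq_card, Fintype.card_fin] at hf
          funext z
          by_cases hz : z = x
          · subst hz; simp [dv, hf]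
          · simp [dv, h1 z hz, Pi.single_eq_of_ne hz]
      · intro z
        by_cases hz : z = x
        · subst hz; simpa using hC'
        · simpa [hz] using isCompl_top_bot
      · intro a b i v _
        rw [fz]
        exact Submodule.zero_mem _
      · intro a b i v _
        rw [fz]
        exact Submodule.zero_mem _
    · right
      have := h x
      rw [Function.update_self] at this
      subst this
      rw [← LinearMap.range_eq_top]
      simpa using hC.sup_eq_top
  · intro z
    by_cases hz : z = x
    · subst hz; simpa using hC
    · simpa [hz] using isCompl_top_bot
  · intro a b i v _
    by_cases hb : b = x
    · subst hb
      rw [Function.update_self]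
      exact ⟨Pi.single (⟨a, i⟩ : Arin Λ b) v, inMap_single Λ M b ⟨a, i⟩ v⟩
    · rw [Function.update_of_ne hb]
      trivial
  · intro a b i v hv
    have ha : a ≠ x := by
      rintro rfl
      exact noarr b i
    rw [Function.update_of_ne ha] at hv
    have : v = 0 := hv
    rw [this, map_zero]
    exact Submodule.zero_mem _

lemma iso_simple {k : Type} [Field k] {n : ℕ} {x : Fin n} {Λ : Fin n → Fin n → ℕ}
    (hx : IsSink Λ x) (M : Rep k n Λ) (h : dv M = Pi.single x 1) : RepIso M (simpleRep Λ x) := by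
  have hd : ∀ z, M.d z = (simpleRep (k := k) Λ x).d z := by
    intro z
    have := congrFun h z
    by_cases hz : z = x
    · subst hz
      simp [dv] at this
      simp [simpleRep]
      exact this
    · simp [dv, Pi.single_eq_of_ne hz] at this
      simp [simpleRep, hz, this]
  refine ⟨fun z => castL k (hd z), ?_⟩
  intro a b i v
  have ha : a ≠ x := by
    rintro rfl
    rw [hx b] at i
    exact i.elim0
  have : v = 0 := by
    funext j
    rw [hd a] at j
    simp [simpleRep, ha] at j
    exact j.elim0
  rw [this]
  simp

lemma equiv_family {k : Type} [Field k] {n : ℕ} (x : Fin n) (p q : Fin n → ℕ)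
    (gx : (Fin (p x) → k) ≃ₗ[k] (Fin (q x) → k))
    (gz : ∀ z, z ≠ x → ((Fin (p z) → k) ≃ₗ[k] (Fin (q z) → k))) :
    ∃ g : ∀ z, (Fin (p z) → k) ≃ₗ[k] (Fin (q z) → k), g x = gx ∧ ∀ z h, g z = gz z h := by
  refine ⟨fun z => if h : z = x then h ▸ gx else gz z h, by simp, ?_⟩
  intro z h
  simp [h]

/-- the map `⊕ N(y) → M(x)` -/
noncomputable def psi {k : Type} [Field k] {n : ℕ} {x : Fin n} {Λ : Fin n → Fin n → ℕ}
    (hx : IsSink Λ x) {M : Rep k n Λ} {N : Rep k n (flipO x Λ)} (D : PlusData x Λ M N) :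
    ((p : Aout (flipO x Λ) x) → (Fin (N.d p.1) → k)) →ₗ[k] (Fin (M.d x) → k) :=
  inMap Λ M x ∘ₗ LinearMap.pi (fun p : Arin Λ x => (D.e p.1 (arin_ne hx p)).toLinearMap ∘ₗ
    LinearMap.proj (φ := fun p : Aout (flipO x Λ) x => (Fin (N.d p.1) → k))
      (⟨p.1, Fin.cast (by simp [flipO]) p.2⟩ : Aout (flipO x Λ) x))

lemma psi_single {k : Type} [Field k] {n : ℕ} {x : Fin n} {Λ : Fin n → Fin n → ℕ}
    (hx : IsSink Λ x) {M : Rep k n Λ} {N : Rep k n (flipO x Λ)} (D : PlusData x Λ M N)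
    (a : Fin n) (ha : a ≠ x) (j : Fin (Λ a x)) (i : Fin (flipO x Λ x a)) (hij : (i : ℕ) = j)
    (w : Fin (N.d a) → k) :
    psi hx D (Pi.single (⟨a, i⟩ : Aout (flipO x Λ) x) w) = M.f a x j (D.e a ha w) := by
  have hi : i = Fin.cast (by simp [flipO]) j := Fin.ext hij
  subst hi
  rw [← inMap_single Λ M x ⟨a, j⟩]
  unfold psi
  rw [LinearMap.comp_apply]
  congr 1
  funext p
  by_cases hp : p = ⟨a, j⟩
  · subst hp
    simp
  · rw [Pi.single_eq_of_ne hp]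
    simp only [LinearMap.pi_apply, LinearMap.comp_apply, LinearMap.proj_apply]
    rw [Pi.single_eq_of_ne, map_zero]
    intro h
    apply hp
    rcases p with ⟨b, l⟩
    obtain ⟨h1, h2⟩ := Sigma.mk.inj h
    subst h1
    have := eq_of_heq h2
    have h3 : l = j := by
      apply Fin.ext
      have := congrArg Fin.val this
      simpa using this
    rw [h3]

lemma psi_surj {k : Type} [Field k] {n : ℕ} {x : Fin n} {Λ : Fin n → Fin n → ℕ}
    (hx : IsSink Λ x) {M : Rep k n Λ} {N : Rep k n (flipO x Λ)} (D : PlusData x Λ M N)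
    (hs : Function.Surjective (inMap Λ M x)) : Function.Surjective (psi hx D) := by
  intro v
  obtain ⟨m, rfl⟩ := hs v
  have hq : ∀ q : Aout (flipO x Λ) x, Λ q.1 x = flipO x Λ x q.1 := by intro q; simp [flipO]
  refine ⟨fun q => (D.e q.1 (arin_ne hx ⟨q.1, Fin.cast (hq q).symm q.2⟩)).symm
    (m ⟨q.1, Fin.cast (hq q).symm q.2⟩), ?_⟩
  unfold psi
  rw [LinearMap.comp_apply]
  congr 1
  funext p
  simp

lemma psi_ker {k : Type} [Field k] {n : ℕ} {x : Fin n} {Λ : Fin n → Fin n → ℕ}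
    (hx : IsSink Λ x) {M : Rep k n Λ} {N : Rep k n (flipO x Λ)} (D : PlusData x Λ M N) :
    LinearMap.range (outMap (flipO x Λ) N x) = LinearMap.ker (psi hx D) := by
  ext u
  constructor
  · rintro ⟨m, rfl⟩
    rw [LinearMap.mem_ker]
    have h0 : inMap Λ M x (D.ex m).1 = 0 := (D.ex m).2
    rw [← h0]
    unfold psi
    rw [LinearMap.comp_apply]
    congr 1
    funext p
    simp only [LinearMap.pi_apply, LinearMap.comp_apply, LinearMap.proj_apply, outMap,
      LinearEquiv.coe_coe]
    exact D.h2 p.1 (arin_ne hx p) _ p.2 rfl m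
  · intro hu
    rw [LinearMap.mem_ker] at hu
    unfold psi at hu
    rw [LinearMap.comp_apply] at hu
    obtain ⟨m, hm⟩ := D.ex.surjective ⟨_, hu⟩
    refine ⟨m, ?_⟩
    funext q
    rcases q with ⟨b, i⟩
    have hbi : flipO x Λ x b = Λ b x := by simp [flipO]
    have hb : b ≠ x := arin_ne hx ⟨b, Fin.cast hbi i⟩
    apply (D.e b hb).injective
    have h1 := D.h2 b hb i (Fin.cast hbi i) rfl m
    rw [hm] at h1
    exact h1

lemma iso_minus {k : Type} [Field k] {n : ℕ} {x : Fin n} {Λ : Fin n → Fin n → ℕ}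
    (hx : IsSink Λ x) {M : Rep k n Λ} {N : Rep k n (flipO x Λ)} (D : PlusData x Λ M N)
    (hs : Function.Surjective (inMap Λ M x)) : RepIso M (reflMinus x Λ N) := by
  let Q := (Submodule.quotEquivOfEq _ _ (psi_ker hx D)).trans
    ((psi hx D).quotKerEquivOfSurjective (psi_surj hx D hs))
  have hdx : (reflMinus x Λ N).d x = _ := if_pos rfl
  have hdz : ∀ z, z ≠ x → (reflMinus x Λ N).d z = N.d z := fun z hz => if_neg hz
  obtain ⟨g, hgx, hgz⟩ := equiv_family (k := k) x M.d (reflMinus x Λ N).d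
    (Q.symm.trans ((cokerEquiv (flipO x Λ) N x).trans (castL k hdx.symm)))
    (fun z hz => (D.e z hz).symm.trans (castL k (hdz z hz).symm))
  refine ⟨g, ?_⟩
  intro a b i v
  have ha : a ≠ x := by
    rintro rfl
    rw [hx b] at i
    exact i.elim0
  by_cases hb : b = x
  · subst hb
    rw [hgx, hgz a ha]
    have hQ : ∀ w, Q (Submodule.Quotient.mk w) = psi hx D w := fun w => rfl
    have h1 : Q.symm (M.f a b i v) = Submodule.Quotient.mk
        (Pi.single (⟨a, Fin.cast (by simp [flipO]) i⟩ : Aout (flipO b Λ) b) ((D.e a ha).symm v)) := by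
      rw [LinearEquiv.symm_apply_eq, hQ, psi_single hx D a ha i _ rfl]
      simp
    simp only [LinearEquiv.trans_apply, h1]
    rw [minus_f_x N ha i (by simp [flipO])]
    simp only [LinearMap.comp_apply, LinearEquiv.coe_coe, castL_castL]
    rfl
  · rw [hgz a ha, hgz b hb]
    rw [minus_f_ne N ha hb i (by simp [flipO, ha, hb])]
    simp only [LinearMap.comp_apply, LinearEquiv.coe_coe, castL_castL, LinearEquiv.trans_apply]
    congr 1
    rw [LinearEquiv.symm_apply_eq, D.h1 a b ha hb _ i rfl]
    simp

end Reps

/-! ## Part 4: assembly -/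

section Final

lemma prd_flip {n : ℕ} (x : Fin n) (Λ : Fin n → Fin n → ℕ) (T : List (Fin n)) :
    prd (cartanOf (flipO x Λ)) (cartan_diag (flipO x Λ)) T =
      prd (cartanOf Λ) (cartan_diag Λ) T := by
  have : ∀ (A B : Fin n → Fin n → ℤ) (hA : ∀ i, A i i = 2) (hB : ∀ i, B i i = 2), A = B →
      prd A hA T = prd B hB T := by
    intro A B hA hB h
    subst h
    rfl
  exact this _ _ _ _ (cartan_flip x Λ)

lemma hit_cons {n : ℕ} (x : Fin n) (Λ : Fin n → Fin n → ℕ) (hx : IsSink Λ x) (d : Fin n → ℤ)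
    (S : List (Fin n)) (h : Hit (flipO x Λ) (sigmaL (cartanOf Λ) x d) S) :
    Hit Λ d (x :: S) := by
  obtain ⟨hS, T, z, rfl, hd⟩ := h
  refine ⟨⟨hx, hS⟩, x :: T, z, rfl, ?_⟩
  rw [prd_flip] at hd
  rw [prd_cons, LinearEquiv.mul_apply, ← hd]
  exact (sigmaL_sigmaL _ (cartan_diag Λ) x d).symm

lemma hit_single {n : ℕ} (x : Fin n) (Λ : Fin n → Fin n → ℕ) (hx : IsSink Λ x) :
    Hit Λ (Pi.single x 1) [x] :=
  ⟨⟨hx, trivial⟩, [], x, rfl, rfl⟩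

lemma exists_hit {k : Type} [Field k] {n : ℕ} (S : List (Fin n)) :
    ∀ (Λ : Fin n → Fin n → ℕ) (M : Rep k n Λ), IndS M → Admissible Λ S → Annihilates Λ S M →
      ∃ S', Hit Λ (dv M) S' := by
  induction S with
  | nil => intro Λ M hM _ h; exact absurd h hM.1
  | cons x xs ih =>
    intro Λ M hM hS h
    rcases sink_cases hS.1 M hM with h1 | h1
    · exact ⟨[x], h1 ▸ hit_single x Λ hS.1⟩
    · obtain ⟨S', hS'⟩ := ih (flipO x Λ) (reflPlus x Λ M)
        (indS_plus hS.1 (plusData x Λ M) h1 hM) hS.2 h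
      rw [dv_plus hS.1 (plusData x Λ M) h1] at hS'
      exact ⟨x :: S', hit_cons x Λ hS.1 _ _ hS'⟩

lemma min_hit {k : Type} [Field k] {n : ℕ} (z : Fin n) (T : List (Fin n)) :
    ∀ (Λ : Fin n → Fin n → ℕ) (M : Rep k n Λ), IndS M → Admissible Λ (T ++ [z]) →
      dv M = prd (cartanOf Λ) (cartan_diag Λ) T (Pi.single z 1) →
      (∀ S', Hit Λ (dv M) S' → (T ++ [z]).length ≤ S'.length) →
      RepIso M (Mof Λ (T ++ [z])) ∧
        ∀ Q, Q <:+ T → 0 ≤ prd (cartanOf Λ) (cartan_diag Λ) Q (Pi.single z 1) := by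
  induction T with
  | nil =>
    intro Λ M hM hS hd _
    refine ⟨iso_simple hS.1 M hd, ?_⟩
    intro Q hQ
    rw [List.suffix_nil.1 hQ, ← hd]
    intro i
    exact Int.natCast_nonneg _
  | cons y T ih =>
    intro Λ M hM hS hd hmin
    rw [List.cons_append] at hS
    rcases sink_cases hS.1 M hM with h1 | h1
    · have := hmin [y] (h1 ▸ hit_single y Λ hS.1)
      simp at this
    · have hdv := dv_plus hS.1 (plusData y Λ M) h1
      have hd' : dv (reflPlus y Λ M) = prd (cartanOf (flipO y Λ)) (cartan_diag (flipO y Λ)) T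
          (Pi.single z 1) := by
        rw [hdv, hd, prd_flip, prd_cons, LinearEquiv.mul_apply]
        exact sigmaL_sigmaL _ (cartan_diag Λ) y _
      obtain ⟨⟨g, hg⟩, hpos⟩ := ih (flipO y Λ) (reflPlus y Λ M)
        (indS_plus hS.1 (plusData y Λ M) h1 hM) hS.2 hd' (by
          intro S' hS'
          rw [hdv] at hS'
          have := hmin _ (hit_cons y Λ hS.1 _ _ hS')
          simpa using this)
      constructor
      · have h := iso_minus hS.1 ((plusData y Λ M).trans g hg) h1
        have e : Mof (k := k) Λ (y :: T ++ [z]) = reflMinus y Λ (Mof (flipO y Λ) (T ++ [z])) := by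
          cases T <;> simp [Mof]
        rw [e]
        exact h
      · intro Q hQ
        rcases List.suffix_cons_iff.1 hQ with rfl | hQ
        · rw [← hd]
          intro i
          exact Int.natCast_nonneg _
        · rw [← prd_flip y]
          exact hpos Q hQ

lemma exists_min_hit {n : ℕ} (Λ : Fin n → Fin n → ℕ) (d : Fin n → ℤ) (h : ∃ S, Hit Λ d S) :
    ∃ S, Hit Λ d S ∧ ∀ S', Hit Λ d S' → S.length ≤ S'.length := by
  obtain ⟨S0, h0⟩ := h
  have hne : {S | Hit Λ d S}.Nonempty := ⟨S0, h0⟩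
  refine ⟨Function.argminOn List.length _ hne, Function.argminOn_mem List.length _ hne, ?_⟩
  intro S' hS'
  exact Function.argminOn_le List.length _ hS'

end Final

theorem indecomposable_preprojective_is_Mof
    (n : ℕ) (hn : 2 ≤ n) (Λ : Fin n → Fin n → ℕ)
    (hloop : ∀ a, Λ a a = 0)
    (hconn : ∀ a b : Fin n, Relation.ReflTransGen (fun u v => edges Λ u v ≠ 0) a b)
    (hacyc : ∀ a : Fin n, ¬ Relation.TransGen (fun u v => Λ u v ≠ 0) a a)
    (k : Type) [Field k]
    (M : Rep k n Λ) (hMi : Indecomp M) (hMp : Preprojective Λ M) :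
    ∃ S : List (Fin n), Admissible Λ S ∧ S ≠ [] ∧ IsReducedSeq Λ S ∧
      RepIso M (Mof Λ S) := by
  have hM := indS_of_indecomp M hMi
  have hnb : ∀ x, ∃ y, edges Λ x y ≠ 0 := by
    intro x
    haveI : Nontrivial (Fin n) := Fin.nontrivial_iff_two_le.2 hn
    obtain ⟨b, hb⟩ := exists_ne x
    rcases Relation.ReflTransGen.cases_head (hconn x b) with h | ⟨c, hc, _⟩
    · exact absurd h.symm hb
    · exact ⟨c, hc⟩
  obtain ⟨S0, hS0, hann⟩ := hMp
  obtain ⟨S, hS, hmin⟩ := exists_min_hit Λ (dv M) (exists_hit S0 Λ M hM hS0 hann)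
  have H2 := min_adj Λ hnb (dv M) S hS hmin
  obtain ⟨hadm, T, z, rfl, hd⟩ := hS
  obtain ⟨hiso, hpos⟩ := min_hit z T Λ M hM hadm hd hmin
  refine ⟨T ++ [z], hadm, by simp, ?_, hiso⟩
  have key := all_pos Λ hloop hnb (T ++ [z]) hadm (by
    intro P x e Q hQ
    obtain ⟨rfl, e2⟩ := List.append_inj' e (by simp)
    obtain rfl : z = x := by simpa using e2
    exact hpos Q hQ) H2
  change wordLen (cartanOf Λ) (cartan_diag Λ) (prd (cartanOf Λ) (cartan_diag Λ) (T ++ [z]).reverse)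
    = (T ++ [z]).length
  rw [len_reverse]
  exact len_eq_of_pos _ _ (cartan_sym Λ) (cartan_neg Λ) _
    (fun P x Q e => key Q.length P x Q rfl e P (List.suffix_refl P))

end KP
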